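/- Let Ω ⊂ ℝⁿ be a bounded John domain and let {U_t}_{t∈Γ} be a tree-covering of Ω obtained from a Whitney decomposition {Q_t}_{t∈Γ} and satisfying W_t ⊆ K Q_t for all t ∈ Γ (where W_t is the shadow of U_t and K > 1). There exists τ_K ≥ 1, depending only on n and K, with the following property: if the exponent function q(·) satisfies 1 < q_- ≤ q_+ < ∞ and q(·) ∈ ∂LH_0^{τ_K}(Ω), then there is a constant C such that for every g ∈ L^{q(·)}(Ω) with ∫_Ω g dx = 0 there exists a family {g_t}_{t∈Γ} ⊂ L¹(Ω) with: (1) g = Σ_{t∈Γ} g_t; (2) supp(g_t) ⊆ U_t for all t; (3) ∫_{U_t} g_t dx = 0 for all t; and (4) ‖Σ_{t∈Γ} χ_{U_t} ‖χ_{U_t} g_t‖_{L^{q(·)}(Ω)}/‖χ_{U_t}‖_{L^{q(·)}(Ω)}‖_{L^{q(·)}(Ω)} ≤ C ‖g‖_{L^{q(·)}(Ω)}. -/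

import Mathlib

open MeasureTheory Metric Set Filter Topology

noncomputable section

abbrev Eucl (n : ℕ) : Type := EuclideanSpace ℝ (Fin n)

/-- Essential supremum of `p` over the set `A` (w.r.t. Lebesgue measure). -/
def essSupOn {n : ℕ} (p : Eucl n → ℝ) (A : Set (Eucl n)) : ℝ :=
  essSup p (volume.restrict A)

/-- Essential infimum of `p` over the set `A` (w.r.t. Lebesgue measure). -/
def essInfOn {n : ℕ} (p : Eucl n → ℝ) (A : Set (Eucl n)) : ℝ :=
  essInf p (volume.restrict A)

/-- The Luxemburg norm of `f` on `A` with variable exponent `p`. -/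
def luxNorm {n : ℕ} (A : Set (Eucl n)) (p f : Eucl n → ℝ) : ℝ :=
  sInf {l : ℝ | 0 < l ∧ (∫⁻ x in A, ENNReal.ofReal ((|f x| / l) ^ (p x))) ≤ 1}

/-- `f` belongs to the variable Lebesgue space `L^{p(·)}(A)`. -/
def MemVarLp {n : ℕ} (A : Set (Eucl n)) (p f : Eucl n → ℝ) : Prop :=
  ∃ l : ℝ, 0 < l ∧ (∫⁻ x in A, ENNReal.ofReal ((|f x| / l) ^ (p x))) ≤ 1

/-- `d(x) = dist(x, ∂Ω)`. -/
def bdist {n : ℕ} (Ω : Set (Eucl n)) (x : Eucl n) : ℝ :=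
  infDist x (frontier Ω)

/-- The ball `B_{x,τ} = B(x, τ d(x))`. -/
def ballB {n : ℕ} (Ω : Set (Eucl n)) (τ : ℝ) (x : Eucl n) : Set (Eucl n) :=
  ball x (τ * bdist Ω x)

/-- The boundary log-Hölder condition `∂LH₀^τ(Ω)` with constant `C₀`. -/
def BoundaryLH {n : ℕ} (Ω : Set (Eucl n)) (p : Eucl n → ℝ) (τ C₀ : ℝ) : Prop :=
  ∀ x ∈ Ω, τ * bdist Ω x ≤ 1 / 2 →
    essSupOn p (ballB Ω τ x ∩ Ω) - essInfOn p (ballB Ω τ x ∩ Ω)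
      ≤ C₀ / (-Real.log (τ * bdist Ω x))

/-- `Ω` is a John domain with parameter `lam`. -/
def JohnDomain {n : ℕ} (Ω : Set (Eucl n)) (lam : ℝ) : Prop :=
  ∃ x₀ ∈ Ω, ∀ y ∈ Ω, ∃ ℓ : ℝ, 0 ≤ ℓ ∧ ∃ γ : ℝ → Eucl n,
    γ 0 = y ∧ γ ℓ = x₀ ∧ (∀ t ∈ Icc (0:ℝ) ℓ, γ t ∈ Ω) ∧
    LipschitzOnWith 1 γ (Icc (0:ℝ) ℓ) ∧
    ∀ t ∈ Icc (0:ℝ) ℓ, t ≤ lam * infDist (γ t) (frontier Ω)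

/-- `g` is uniformly `ε`-continuous on `S`. -/
def UnifEpsCont {n : ℕ} (S : Set (Eucl n)) (g : Eucl n → ℝ) (ε : ℝ) : Prop :=
  ∃ δ : ℝ, 0 < δ ∧ ∀ x ∈ S, ∀ y ∈ S, dist x y < δ → |g y - g x| < ε

/-- `f` is locally Lipschitz on `S`. -/
def LocLipschitzOn {n : ℕ} (S : Set (Eucl n)) (f : Eucl n → ℝ) : Prop :=
  ∀ x ∈ S, ∃ K : NNReal, ∃ t ∈ 𝓝 x, LipschitzOnWith K f (t ∩ S)

/-- The average of `f` over `A`. -/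
def avgOn {n : ℕ} (A : Set (Eucl n)) (f : Eucl n → ℝ) : ℝ :=
  (volume A).toReal⁻¹ * ∫ x in A, f x

/-- The pointwise dual (conjugate) exponent `p'`, `1/p + 1/p' = 1`. -/
def dualExp {α : Type*} (p : α → ℝ) : α → ℝ :=
  fun x => p x / (p x - 1)

/-- The norm of the a.e.-defined gradient of `f`. -/
def gradNorm {n : ℕ} (f : Eucl n → ℝ) : Eucl n → ℝ :=
  fun x => ‖fderiv ℝ f x‖

/-- The closed dyadic cube of generation `k` with lattice coordinates `z`. -/
def cubeQ {n : ℕ} (k : ℤ) (z : Fin n → ℤ) : Set (Eucl n) :=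
  {x | ∀ i, |x i - ((z i : ℝ) + 1 / 2) * (2:ℝ) ^ (-k)| ≤ (2:ℝ) ^ (-k) / 2}

/-- The expanded open cube `U = (17/16)·int(Q)`. -/
def cubeU {n : ℕ} (k : ℤ) (z : Fin n → ℤ) : Set (Eucl n) :=
  {x | ∀ i, |x i - ((z i : ℝ) + 1 / 2) * (2:ℝ) ^ (-k)| < (17 / 16) * ((2:ℝ) ^ (-k) / 2)}

/-- The dilation `K·Q` of the cube `Q` about its center. -/
def cubeDil {n : ℕ} (K : ℝ) (k : ℤ) (z : Fin n → ℤ) : Set (Eucl n) :=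
  {x | ∀ i, |x i - ((z i : ℝ) + 1 / 2) * (2:ℝ) ^ (-k)| ≤ K * ((2:ℝ) ^ (-k) / 2)}

/-- Distance between two sets. -/
def setDist {n : ℕ} (A B : Set (Eucl n)) : ℝ :=
  sInf (Set.image2 dist A B)

/-- A tree-covering of a bounded domain `Ω` obtained from a Whitney decomposition,
with `U_t = (17/16)·int(Q_t)` (Remark 3.2). -/
structure WhitneyTreeCovering (n : ℕ) (Ω : Set (Eucl n)) where
  ι : Type
  countable : Countable ι
  kk : ι → ℤ
  zz : ι → Fin n → ℤ
  disjQ : ∀ s t : ι, s ≠ t →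
    Disjoint (interior (cubeQ (kk s) (zz s))) (interior (cubeQ (kk t) (zz t)))
  unionQ : (⋃ t : ι, cubeQ (kk t) (zz t)) = Ω
  whitney₁ : ∀ t, Metric.diam (cubeQ (kk t) (zz t))
    ≤ setDist (cubeQ (kk t) (zz t)) (frontier Ω)
  whitney₂ : ∀ t, setDist (cubeQ (kk t) (zz t)) (frontier Ω)
    ≤ 4 * Metric.diam (cubeQ (kk t) (zz t))
  neighbor : ∀ s t : ι, (cubeQ (kk s) (zz s) ∩ cubeQ (kk t) (zz t)).Nonempty →
    Metric.diam (cubeQ (kk t) (zz t)) ≤ 4 * Metric.diam (cubeQ (kk s) (zz s))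
  root : ι
  parent : ι → ι
  parent_root : parent root = root
  reach : ∀ t : ι, ∃ m : ℕ, parent^[m] t = root
  C₁ : ℝ
  one_le_C₁ : 1 ≤ C₁
  cover : ∀ᵐ x ∂(volume : Measure (Eucl n)),
    (x ∈ Ω → 1 ≤ ∑' t : ι, Set.indicator (cubeU (kk t) (zz t)) (fun _ => (1:ℝ)) x) ∧
    (∑' t : ι, Set.indicator (cubeU (kk t) (zz t)) (fun _ => (1:ℝ)) x
      ≤ C₁ * Set.indicator Ω (fun _ => (1:ℝ)) x)
  Bt : ι → Set (Eucl n)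
  Bt_open : ∀ t, IsOpen (Bt t)
  Bt_sub : ∀ t, t ≠ root → Bt t ⊆ cubeU (kk t) (zz t) ∩ cubeU (kk (parent t)) (zz (parent t))
  Bt_disj : ∀ s t, s ≠ root → t ≠ root → s ≠ t → Disjoint (Bt s) (Bt t)
  C₂ : ℝ
  meas_ratio : ∀ t, t ≠ root →
    (volume (cubeU (kk t) (zz t))).toReal ≤ C₂ * (volume (Bt t)).toReal

/-- The Whitney cube `Q_t`. -/
def WhitneyTreeCovering.Q {n : ℕ} {Ω : Set (Eucl n)} (T : WhitneyTreeCovering n Ω)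
    (t : T.ι) : Set (Eucl n) := cubeQ (T.kk t) (T.zz t)

/-- The expanded cube `U_t`. -/
def WhitneyTreeCovering.U {n : ℕ} {Ω : Set (Eucl n)} (T : WhitneyTreeCovering n Ω)
    (t : T.ι) : Set (Eucl n) := cubeU (T.kk t) (T.zz t)

/-- The shadow `W_t = ⋃_{s ⪰ t} U_s`. -/
def WhitneyTreeCovering.shadow {n : ℕ} {Ω : Set (Eucl n)} (T : WhitneyTreeCovering n Ω)
    (t : T.ι) : Set (Eucl n) :=
  ⋃ s ∈ {s : T.ι | ∃ m : ℕ, T.parent^[m] s = t}, T.U s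

/-- The characteristic function of a set, as a real valued function. -/
def charFun {n : ℕ} (A : Set (Eucl n)) : Eucl n → ℝ :=
  Set.indicator A (fun _ => (1:ℝ))

/-! ### Rooted trees given by a parent map and a depth function -/

section Tree

variable {ι : Type*}

/-- The descendants of `t` exactly `k` generations below it. -/
def treeLevel (parent : ι → ι) (depth : ι → ℕ) (k : ℕ) (t : ι) : Set ι :=
  {s | parent^[k] s = t ∧ depth s = depth t + k}

/-- The children of `t`. -/
def treeChildren (parent : ι → ι) (root : ι) (t : ι) : Set ι :=
  {c | c ≠ root ∧ parent c = t}

/-- All descendants of `t`, including `t` itself. -/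
def treeDesc (parent : ι → ι) (depth : ι → ℕ) (t : ι) : Set ι :=
  ⋃ k, treeLevel parent depth k t

theorem exists_depth (parent : ι → ι) (root : ι)
    (reach : ∀ t, ∃ m : ℕ, parent^[m] t = root) :
    ∃ depth : ι → ℕ, depth root = 0 ∧ ∀ c, c ≠ root → depth c = depth (parent c) + 1 := by
  classical
  refine ⟨fun t => Nat.find (reach t), ?_, ?_⟩
  · simp
  · intro c hc
    have h0 : ¬ parent^[0] c = root := by simpa using hc
    have h1 : ∃ m : ℕ, parent^[m + 1] c = root := by
      obtain ⟨m, hm⟩ := reach c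
      cases m with
      | zero => exact absurd hm h0
      | succ m => exact ⟨m, hm⟩
    have := Nat.find_comp_succ (reach c) h1 h0
    simpa [Function.iterate_succ_apply] using this

variable {parent : ι → ι} {root : ι} {depth : ι → ℕ}

theorem treeLevel_zero (t : ι) : treeLevel parent depth 0 t = {t} := by
  ext s
  simp only [treeLevel, Function.iterate_zero, id_eq, add_zero, mem_ofPred_eq, mem_singleton_iff]
  exact ⟨fun h => h.1, fun h => ⟨h, by rw [h]⟩⟩

theorem iterate_depth_eq_root (h0 : depth root = 0)
    (hd : ∀ c, c ≠ root → depth c = depth (parent c) + 1) (s : ι) :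
    parent^[depth s] s = root := by
  induction h : depth s generalizing s with
  | zero =>
    by_contra hs
    have := hd s hs
    omega
  | succ k ih =>
    have hs : s ≠ root := by
      rintro rfl
      omega
    have := hd s hs
    rw [Function.iterate_succ_apply]
    exact ih _ (by omega)

theorem treeDesc_root (h0 : depth root = 0)
    (hd : ∀ c, c ≠ root → depth c = depth (parent c) + 1) :
    treeDesc parent depth root = univ := by
  refine eq_univ_of_forall fun s => mem_iUnion.2 ⟨depth s, ?_, by omega⟩
  exact iterate_depth_eq_root h0 hd s

theorem depth_le_iterate (h0 : depth root = 0)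
    (hd : ∀ c, c ≠ root → depth c = depth (parent c) + 1) (k : ℕ) (s : ι) :
    depth s ≤ depth (parent^[k] s) + k := by
  induction k generalizing s with
  | zero => simp
  | succ k ih =>
    rw [Function.iterate_succ_apply]
    have := ih (parent s)
    by_cases hs : s = root
    · rw [hs, h0]; omega
    · have := hd s hs
      omega

theorem mem_treeLevel_succ (h0 : depth root = 0)
    (hd : ∀ c, c ≠ root → depth c = depth (parent c) + 1) (k : ℕ) (s t : ι) :
    s ∈ treeLevel parent depth (k + 1) t ↔
      parent^[k] s ∈ treeChildren parent root t ∧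
        s ∈ treeLevel parent depth k (parent^[k] s) := by
  constructor
  · rintro ⟨h1, h2⟩
    rw [Function.iterate_succ_apply'] at h1
    have h3 := depth_le_iterate h0 hd k s
    have hne : parent^[k] s ≠ root := by
      intro h
      rw [h, h0] at h3
      omega
    have h4 := hd _ hne
    rw [h1] at h4
    exact ⟨⟨hne, h1⟩, rfl, by omega⟩
  · rintro ⟨⟨h1, h2⟩, -, h3⟩
    have h4 := hd _ h1
    rw [h2] at h4
    exact ⟨by rw [Function.iterate_succ_apply', h2], by omega⟩

theorem treeLevel_level_unique {k k' : ℕ} {s t : ι} (h : s ∈ treeLevel parent depth k t)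
    (h' : s ∈ treeLevel parent depth k' t) : k = k' := by
  have := h.2
  have := h'.2
  omega

theorem treeDesc_eq (h0 : depth root = 0)
    (hd : ∀ c, c ≠ root → depth c = depth (parent c) + 1) (t : ι) :
    treeDesc parent depth t =
      {t} ∪ ⋃ c ∈ treeChildren parent root t, treeDesc parent depth c := by
  ext s
  simp only [treeDesc, mem_iUnion, mem_union, mem_singleton_iff, exists_prop]
  constructor
  · rintro ⟨k, hk⟩
    cases k with
    | zero => rw [treeLevel_zero] at hk; exact Or.inl hk
    | succ k =>
      rw [mem_treeLevel_succ h0 hd] at hk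
      exact Or.inr ⟨_, hk.1, k, hk.2⟩
  · rintro (rfl | ⟨c, hc, k, hk⟩)
    · exact ⟨0, by rw [treeLevel_zero]; rfl⟩
    · refine ⟨k + 1, ?_⟩
      rw [mem_treeLevel_succ h0 hd, hk.1]
      exact ⟨hc, hk⟩

theorem notMem_treeDesc_child (hd : ∀ c, c ≠ root → depth c = depth (parent c) + 1) {t c : ι}
    (hc : c ∈ treeChildren parent root t) : t ∉ treeDesc parent depth c := by
  intro h
  obtain ⟨k, -, hk⟩ := mem_iUnion.1 h
  have := hd c hc.1
  rw [hc.2] at this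
  omega

theorem disjoint_treeDesc_children (hd : ∀ c, c ≠ root → depth c = depth (parent c) + 1)
    {t c c' : ι} (hc : c ∈ treeChildren parent root t) (hc' : c' ∈ treeChildren parent root t)
    (hne : c ≠ c') : Disjoint (treeDesc parent depth c) (treeDesc parent depth c') := by
  refine Set.disjoint_left.2 fun s hs hs' => hne ?_
  obtain ⟨k, h1, hk⟩ := mem_iUnion.1 hs
  obtain ⟨k', hpar, hk'⟩ := mem_iUnion.1 hs'
  have e1 := hd c hc.1
  have e2 := hd c' hc'.1
  rw [hc.2] at e1
  rw [hc'.2] at e2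
  obtain rfl : k = k' := by omega
  rw [← h1, ← hpar]

/-- The sum of `f` over the descendants of `t` in the `k`-th generation. -/
def levelSum (parent : ι → ι) (depth : ι → ℕ) (f : ι → ENNReal) (k : ℕ) (t : ι) : ENNReal :=
  ∑' s, (treeLevel parent depth k t).indicator f s

theorem levelSum_zero (f : ι → ENNReal) (t : ι) : levelSum parent depth f 0 t = f t := by
  rw [levelSum, treeLevel_zero, tsum_eq_single t]
  · simp
  · intro s hs
    simp [hs]

theorem levelSum_succ (h0 : depth root = 0)
    (hd : ∀ c, c ≠ root → depth c = depth (parent c) + 1) (f : ι → ENNReal) (k : ℕ) (t : ι) :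
    levelSum parent depth f (k + 1) t =
      ∑' c, (treeChildren parent root t).indicator (levelSum parent depth f k) c := by
  classical
  have h1 : ∀ c, (treeChildren parent root t).indicator (levelSum parent depth f k) c =
      ∑' s, if c ∈ treeChildren parent root t ∧ s ∈ treeLevel parent depth k c
        then f s else 0 := by
    intro c
    by_cases hc : c ∈ treeChildren parent root t
    · simp [hc, levelSum, Set.indicator_apply]
    · simp [hc]
  simp_rw [h1]
  rw [ENNReal.tsum_comm, levelSum]
  refine tsum_congr fun s => ?_
  rw [tsum_eq_single (parent^[k] s)]
  · simp only [Set.indicator_apply, mem_treeLevel_succ h0 hd]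
  · intro c hc
    rw [if_neg]
    rintro ⟨-, h, -⟩
    exact hc h.symm

theorem tsum_levelSum_eq (h0 : depth root = 0)
    (hd : ∀ c, c ≠ root → depth c = depth (parent c) + 1) (f : ι → ENNReal) (t : ι) :
    ∑' k, levelSum parent depth f k t = f t +
      ∑' c, (treeChildren parent root t).indicator
        (fun c => ∑' k, levelSum parent depth f k c) c := by
  rw [tsum_eq_zero_add' ENNReal.summable, levelSum_zero]
  simp_rw [levelSum_succ h0 hd]
  rw [ENNReal.tsum_comm]
  congr 1
  refine tsum_congr fun c => ?_
  by_cases hc : c ∈ treeChildren parent root t <;> simp [hc]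

/-- Under a Carleson condition the mass of the generations decays geometrically. -/
theorem tsum_pow_mul_levelSum_le (h0 : depth root = 0)
    (hd : ∀ c, c ≠ root → depth c = depth (parent c) + 1) (w : ι → ENNReal) (A ε : ENNReal)
    (hA : ∀ t, ∑' k, levelSum parent depth w k t ≤ A * w t) (hε : 2 * ε * A ≤ 1) (t : ι) :
    ∑' k, (1 + ε) ^ k * levelSum parent depth w k t ≤ 2 * A * w t := by
  suffices h : ∀ (N : ℕ) (t : ι), ∑ k ∈ Finset.range N, (1 + ε) ^ k * levelSum parent depth w k t
      ≤ 2 * ∑' k, levelSum parent depth w k t by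
    rw [ENNReal.tsum_eq_iSup_nat]
    refine iSup_le fun N => (h N t).trans ?_
    rw [mul_assoc]
    gcongr
    exact hA t
  intro N
  induction N with
  | zero => simp
  | succ N ih =>
    intro t
    set S := ∑' c, (treeChildren parent root t).indicator
        (fun c => ∑' k, levelSum parent depth w k c) c with hS
    have hσ := tsum_levelSum_eq h0 hd w t
    rw [← hS] at hσ
    have hSA : S ≤ A * w t := le_trans (by rw [hσ]; exact le_add_self) (hA t)
    rw [Finset.sum_range_succ', levelSum_zero, hσ]
    have h1 : ∑ k ∈ Finset.range N, (1 + ε) ^ (k + 1) * levelSum parent depth w (k + 1) t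
        ≤ (1 + ε) * (2 * S) := by
      simp_rw [levelSum_succ h0 hd, pow_succ', mul_assoc, ← Finset.mul_sum]
      gcongr
      simp_rw [← ENNReal.tsum_mul_left]
      rw [← Summable.tsum_finsetSum (fun _ _ => ENNReal.summable)]
      rw [hS, ← ENNReal.tsum_mul_left]
      refine ENNReal.tsum_le_tsum fun c => ?_
      by_cases hc : c ∈ treeChildren parent root t
      · simpa [hc] using ih c
      · simp [hc]
    calc _ ≤ (1 + ε) * (2 * S) + 1 * w t := by
          simp only [pow_zero]
          gcongr
      _ = 2 * S + (2 * ε * S + w t) := by ring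
      _ ≤ 2 * S + (2 * ε * (A * w t) + w t) := by gcongr
      _ = 2 * S + ((2 * ε * A) * w t + w t) := by ring
      _ ≤ 2 * S + (1 * w t + w t) := by gcongr
      _ = 2 * (w t + S) := by ring

theorem tsum_levelSum_parents_le (f : ι → ENNReal) (k : ℕ) :
    ∑' t, levelSum parent depth f k t ≤ ∑' s, f s := by
  simp_rw [levelSum]
  rw [ENNReal.tsum_comm]
  refine ENNReal.tsum_le_tsum fun s => ?_
  rw [tsum_eq_single (parent^[k] s)]
  · exact Set.indicator_le_self _ _ _
  · intro t ht
    refine Set.indicator_of_notMem (fun h => ht h.1.symm) _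

theorem tsum_children_le (f : ι → ENNReal) :
    ∑' t, ∑' c, (treeChildren parent root t).indicator f c ≤ ∑' c, f c := by
  rw [ENNReal.tsum_comm]
  refine ENNReal.tsum_le_tsum fun c => ?_
  rw [tsum_eq_single (parent c)]
  · exact Set.indicator_le_self _ _ _
  · intro t ht
    exact Set.indicator_of_notMem (fun h => ht h.2.symm) _

theorem tsum_levelSum_le_tsum_treeDesc (f : ι → ENNReal) (t : ι) :
    ∑' k, levelSum parent depth f k t ≤ ∑' s, (treeDesc parent depth t).indicator f s := by
  simp_rw [levelSum]
  rw [ENNReal.tsum_comm]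
  refine ENNReal.tsum_le_tsum fun s => ?_
  by_cases hs : s ∈ treeDesc parent depth t
  · obtain ⟨k, hk⟩ := mem_iUnion.1 hs
    rw [tsum_eq_single k]
    · simp [hs, hk]
    · intro k' hk'
      exact Set.indicator_of_notMem (fun h => hk' (treeLevel_level_unique h hk)) _
  · have : ∀ k, s ∉ treeLevel parent depth k t := fun k hk => hs (mem_iUnion.2 ⟨k, hk⟩)
    simp [this]

/-- The local step of the Hardy inequality on a tree. -/
theorem hardy_tree_local (h0 : depth root = 0)
    (hd : ∀ c, c ≠ root → depth c = depth (parent c) + 1) {w : ι → ℝ} (hw : ∀ t, 0 < w t)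
    {A : ℝ} (hA1 : 1 ≤ A)
    (hA : ∀ t, ∑' k, levelSum parent depth (fun s => ENNReal.ofReal (w s)) k t
      ≤ ENNReal.ofReal A * ENNReal.ofReal (w t))
    (a G : ι → ENNReal) {p Qp m α : ℝ} (hp : 1 < p) (hm : p ≤ m) (hmQ : m ≤ Qp) (hα : 0 ≤ α)
    (t : ι)
    (ha : ∀ k, ∀ s ∈ treeLevel parent depth k t, ∀ y : ℝ, 0 < y →
      a s ≤ ENNReal.ofReal y * ENNReal.ofReal (w s) + ENNReal.ofReal (y ^ (1 - m)) * G s)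
    (hαS : ENNReal.ofReal (α * w t) ≤ ∑' k, levelSum parent depth a k t) :
    ENNReal.ofReal (w t * α ^ m) ≤ ENNReal.ofReal (2 * (4 * A) ^ Qp) *
      ∑' k, ENNReal.ofReal ((1 + 1 / (2 * A)) ^ (1 - p)) ^ k * levelSum parent depth G k t := by
  have hA0 : 0 < A := by linarith
  rcases hα.eq_or_lt with rfl | hα
  · rw [Real.zero_rpow (by linarith)]
    simp
  set r : ℝ := 1 + 1 / (2 * A) with hr
  have hr1 : 1 ≤ r := by rw [hr]; have : 0 < 1 / (2 * A) := by positivity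
                         linarith
  have hr0 : 0 < r := by linarith
  set R := ∑' k, ENNReal.ofReal (r ^ (1 - p)) ^ k * levelSum parent depth G k t with hR
  set lam : ℝ := α / (4 * A) with hlam
  have hlam0 : 0 < lam := by positivity
  have hdecay : ∑' k, ENNReal.ofReal r ^ k *
      levelSum parent depth (fun s => ENNReal.ofReal (w s)) k t
      ≤ 2 * ENNReal.ofReal A * ENNReal.ofReal (w t) := by
    have := tsum_pow_mul_levelSum_le h0 hd (fun s => ENNReal.ofReal (w s)) (ENNReal.ofReal A)
      (ENNReal.ofReal (1 / (2 * A))) hA ?_ t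
    · rwa [← ENNReal.ofReal_one, ← ENNReal.ofReal_add zero_le_one (by positivity)] at this
    · rw [show (2 : ENNReal) = ENNReal.ofReal 2 by simp, ← ENNReal.ofReal_mul (by positivity),
        ← ENNReal.ofReal_mul (by positivity)]
      refine ENNReal.ofReal_le_one.2 (le_of_eq ?_)
      field_simp
  have hlev : ∀ k, levelSum parent depth a k t ≤
      ENNReal.ofReal lam * (ENNReal.ofReal r ^ k *
        levelSum parent depth (fun s => ENNReal.ofReal (w s)) k t) +
      ENNReal.ofReal (lam ^ (1 - m)) * (ENNReal.ofReal (r ^ (1 - p)) ^ k *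
        levelSum parent depth G k t) := by
    intro k
    simp_rw [levelSum, ← ENNReal.tsum_mul_left]
    rw [← ENNReal.tsum_add]
    refine ENNReal.tsum_le_tsum fun s => ?_
    by_cases hs : s ∈ treeLevel parent depth k t
    · simp only [Set.indicator_of_mem hs]
      refine (ha k s hs (lam * r ^ k) (by positivity)).trans ?_
      rw [ENNReal.ofReal_mul hlam0.le, ENNReal.ofReal_pow hr0.le, mul_assoc]
      refine add_le_add le_rfl ?_
      rw [← mul_assoc]
      gcongr
      rw [← ENNReal.ofReal_pow (by positivity), ← ENNReal.ofReal_mul (by positivity)]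
      refine ENNReal.ofReal_le_ofReal ?_
      rw [Real.mul_rpow hlam0.le (by positivity)]
      gcongr
      rw [← Real.rpow_natCast, ← Real.rpow_natCast, ← Real.rpow_mul hr0.le,
        ← Real.rpow_mul hr0.le]
      refine Real.rpow_le_rpow_of_exponent_le hr1 ?_
      rw [mul_comm]
      gcongr
    · simp [hs]
  have hsum : ENNReal.ofReal (α * w t) ≤
      ENNReal.ofReal (α * w t / 2) + ENNReal.ofReal (lam ^ (1 - m)) * R := by
    refine hαS.trans ((ENNReal.tsum_le_tsum hlev).trans ?_)
    rw [ENNReal.tsum_add, ENNReal.tsum_mul_left, ENNReal.tsum_mul_left]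
    refine add_le_add ?_ le_rfl
    calc _ ≤ ENNReal.ofReal lam * (2 * ENNReal.ofReal A * ENNReal.ofReal (w t)) := by gcongr
      _ = ENNReal.ofReal (lam * (2 * A * w t)) := by
        rw [show (2 : ENNReal) = ENNReal.ofReal 2 by simp, ← ENNReal.ofReal_mul (by positivity),
          ← ENNReal.ofReal_mul (by positivity), ← ENNReal.ofReal_mul (by positivity)]
      _ = _ := by
        congr 1
        rw [hlam]
        field_simp
        norm_num
  have hwt := hw t
  have hhalf : ENNReal.ofReal (α * w t / 2) ≤ ENNReal.ofReal (lam ^ (1 - m)) * R := by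
    have e : ENNReal.ofReal (α * w t)
        = ENNReal.ofReal (α * w t / 2) + ENNReal.ofReal (α * w t / 2) := by
      rw [← ENNReal.ofReal_add (by positivity) (by positivity)]
      congr 1
      ring
    rw [e] at hsum
    exact (ENNReal.add_le_add_iff_left ENNReal.ofReal_ne_top).1 hsum
  have hpow : α ^ m = α * α ^ (m - 1) := by
    rw [← Real.rpow_one_add' hα.le (by linarith)]
    congr 1
    ring
  calc ENNReal.ofReal (w t * α ^ m)
      = ENNReal.ofReal (2 * α ^ (m - 1)) * ENNReal.ofReal (α * w t / 2) := by
        rw [← ENNReal.ofReal_mul (by positivity)]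
        congr 1
        rw [hpow]
        ring
    _ ≤ ENNReal.ofReal (2 * α ^ (m - 1)) * (ENNReal.ofReal (lam ^ (1 - m)) * R) := by gcongr
    _ = ENNReal.ofReal (2 * (4 * A) ^ (m - 1)) * R := by
        rw [← mul_assoc, ← ENNReal.ofReal_mul (by positivity)]
        congr 2
        rw [hlam, Real.div_rpow hα.le (by positivity), show 1 - m = -(m - 1) by ring,
          Real.rpow_neg hα.le, Real.rpow_neg (by positivity)]
        have : 0 < α ^ (m - 1) := by positivity
        field_simp
    _ ≤ ENNReal.ofReal (2 * (4 * A) ^ Qp) * R := by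
        gcongr
        · linarith
        · linarith

/-- The Hardy inequality on a tree with varying exponents. -/
theorem hardy_tree (h0 : depth root = 0)
    (hd : ∀ c, c ≠ root → depth c = depth (parent c) + 1) {w : ι → ℝ} (hw : ∀ t, 0 < w t)
    {A : ℝ} (hA1 : 1 ≤ A)
    (hA : ∀ t, ∑' k, levelSum parent depth (fun s => ENNReal.ofReal (w s)) k t
      ≤ ENNReal.ofReal A * ENNReal.ofReal (w t))
    (a G : ι → ENNReal) {p Qp : ℝ} {m α : ι → ℝ} (hp : 1 < p) (hm : ∀ t, p ≤ m t)
    (hmQ : ∀ t, m t ≤ Qp) (hα : ∀ t, 0 ≤ α t)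
    (ha : ∀ t k, ∀ s ∈ treeLevel parent depth k t, ∀ y : ℝ, 0 < y →
      a s ≤ ENNReal.ofReal y * ENNReal.ofReal (w s) + ENNReal.ofReal (y ^ (1 - m t)) * G s)
    (hαS : ∀ t, ENNReal.ofReal (α t * w t) ≤ ∑' k, levelSum parent depth a k t) :
    ∑' t, ENNReal.ofReal (w t * α t ^ m t) ≤ ENNReal.ofReal (2 * (4 * A) ^ Qp) *
      ((1 - ENNReal.ofReal ((1 + 1 / (2 * A)) ^ (1 - p)))⁻¹ * ∑' s, G s) := by
  refine (ENNReal.tsum_le_tsum fun t => hardy_tree_local h0 hd hw hA1 hA a G hp (hm t) (hmQ t)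
    (hα t) t (ha t) (hαS t)).trans ?_
  rw [ENNReal.tsum_mul_left, ENNReal.tsum_comm]
  gcongr
  simp_rw [ENNReal.tsum_mul_left]
  rw [← ENNReal.tsum_geometric, ← ENNReal.tsum_mul_right]
  exact ENNReal.tsum_le_tsum fun k => mul_le_mul' le_rfl (tsum_levelSum_parents_le G k)

end Tree

/-! ### Geometry of Whitney cubes -/

section Cubes

variable {n : ℕ}

/-- The volume `2 ^ (-k n)` of a dyadic cube of generation `k`. -/
def cubeVol (n : ℕ) (k : ℤ) : ℝ := ((2 : ℝ) ^ (-k)) ^ n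

theorem cubeVol_pos (k : ℤ) : 0 < cubeVol n k := by
  unfold cubeVol
  positivity

/-- The open dyadic cube of generation `k` with lattice coordinates `z`. -/
def cubeO (k : ℤ) (z : Fin n → ℤ) : Set (Eucl n) :=
  {x | ∀ i, |x i - ((z i : ℝ) + 1 / 2) * (2:ℝ) ^ (-k)| < (2:ℝ) ^ (-k) / 2}

theorem volume_setOf_abs_sub_lt (c : Fin n → ℝ) {r : ℝ} (hr : 0 < r) :
    volume {x : Eucl n | ∀ i, |x i - c i| < r} = ENNReal.ofReal ((2 * r) ^ n) := by
  have h := Real.volume_pi_ball c hr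
  rw [Fintype.card_fin] at h
  rw [← h, ← (PiLp.volume_preserving_ofLp (Fin n)).measure_preimage
    measurableSet_ball.nullMeasurableSet]
  congr 1
  ext x
  simp [dist_pi_lt_iff hr, Real.dist_eq]

theorem volume_setOf_abs_sub_le (c : Fin n → ℝ) {r : ℝ} (hr : 0 ≤ r) :
    volume {x : Eucl n | ∀ i, |x i - c i| ≤ r} = ENNReal.ofReal ((2 * r) ^ n) := by
  have h := Real.volume_pi_closedBall c hr
  rw [Fintype.card_fin] at h
  rw [← h, ← (PiLp.volume_preserving_ofLp (Fin n)).measure_preimage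
    measurableSet_closedBall.nullMeasurableSet]
  congr 1
  ext x
  simp [dist_pi_le_iff hr, Real.dist_eq]

theorem isOpen_setOf_abs_sub_lt (c : Fin n → ℝ) (r : ℝ) :
    IsOpen {x : Eucl n | ∀ i, |x i - c i| < r} := by
  have : {x : Eucl n | ∀ i, |x i - c i| < r} = ⋂ i, {x : Eucl n | |x i - c i| < r} := by
    ext x
    simp
  rw [this]
  exact isOpen_iInter_of_finite fun i => isOpen_lt (by fun_prop) continuous_const

theorem volume_cubeO (k : ℤ) (z : Fin n → ℤ) :
    volume (cubeO k z) = ENNReal.ofReal (cubeVol n k) := by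
  rw [cubeO, volume_setOf_abs_sub_lt (fun i => ((z i : ℝ) + 1 / 2) * (2:ℝ) ^ (-k)) (by positivity),
    cubeVol]
  congr 2
  ring

theorem volume_cubeQ (k : ℤ) (z : Fin n → ℤ) :
    volume (cubeQ k z) = ENNReal.ofReal (cubeVol n k) := by
  rw [cubeQ, volume_setOf_abs_sub_le (fun i => ((z i : ℝ) + 1 / 2) * (2:ℝ) ^ (-k)) (by positivity),
    cubeVol]
  congr 2
  ring

theorem volume_cubeU (k : ℤ) (z : Fin n → ℤ) :
    volume (cubeU k z) = ENNReal.ofReal ((17 / 16) ^ n * cubeVol n k) := by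
  rw [cubeU, volume_setOf_abs_sub_lt (fun i => ((z i : ℝ) + 1 / 2) * (2:ℝ) ^ (-k)) (by positivity),
    cubeVol, ← mul_pow]
  congr 2
  ring

theorem volume_cubeDil {K : ℝ} (hK : 0 ≤ K) (k : ℤ) (z : Fin n → ℤ) :
    volume (cubeDil K k z) = ENNReal.ofReal (K ^ n) * ENNReal.ofReal (cubeVol n k) := by
  rw [cubeDil, volume_setOf_abs_sub_le (fun i => ((z i : ℝ) + 1 / 2) * (2:ℝ) ^ (-k))
    (by positivity), cubeVol, ← ENNReal.ofReal_mul (by positivity), ← mul_pow]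
  congr 2
  ring

theorem isOpen_cubeO (k : ℤ) (z : Fin n → ℤ) : IsOpen (cubeO k z) :=
  isOpen_setOf_abs_sub_lt _ _

theorem isOpen_cubeU (k : ℤ) (z : Fin n → ℤ) : IsOpen (cubeU k z) :=
  isOpen_setOf_abs_sub_lt _ _

theorem cubeO_subset_cubeQ (k : ℤ) (z : Fin n → ℤ) : cubeO k z ⊆ cubeQ k z :=
  fun _ hx i => (hx i).le

theorem cubeO_subset_cubeU (k : ℤ) (z : Fin n → ℤ) : cubeO k z ⊆ cubeU k z := by
  intro x hx i
  have h : (0:ℝ) < 2 ^ (-k) := by positivity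
  have := hx i
  linarith

theorem volume_cubeQ_diff_cubeO (k : ℤ) (z : Fin n → ℤ) :
    volume (cubeQ k z \ cubeO k z) = 0 := by
  rw [measure_sdiff (cubeO_subset_cubeQ k z) (isOpen_cubeO k z).measurableSet.nullMeasurableSet
    (by rw [volume_cubeO]; exact ENNReal.ofReal_ne_top), volume_cubeO, volume_cubeQ, tsub_self]

theorem norm_le_of_forall_abs_le (v : Eucl n) {a : ℝ} (ha : 0 ≤ a) (h : ∀ i, |v i| ≤ a) :
    ‖v‖ ≤ n * a := by
  rw [EuclideanSpace.norm_eq]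
  refine Real.sqrt_le_iff.2 ⟨by positivity, ?_⟩
  calc ∑ i, ‖v i‖ ^ 2 ≤ ∑ _i : Fin n, a ^ 2 := by
        gcongr with i
        exact h i
    _ = n * a ^ 2 := by simp
    _ ≤ (n * a) ^ 2 := by
        rw [mul_pow]
        gcongr
        exact_mod_cast Nat.le_self_pow two_ne_zero n

/-- The center of a dyadic cube. -/
def cubeCenter (k : ℤ) (z : Fin n → ℤ) : Eucl n :=
  WithLp.toLp 2 fun i => ((z i : ℝ) + 1 / 2) * (2:ℝ) ^ (-k)

theorem cubeCenter_mem_cubeQ (k : ℤ) (z : Fin n → ℤ) : cubeCenter k z ∈ cubeQ k z := by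
  intro i
  simp only [cubeCenter, sub_self, abs_zero]
  positivity

theorem dist_cubeCenter_le {K : ℝ} (hK : 0 ≤ K) (k : ℤ) (z : Fin n → ℤ) {x : Eucl n}
    (hx : x ∈ cubeDil K k z) : dist x (cubeCenter k z) ≤ n * (K * ((2:ℝ) ^ (-k) / 2)) := by
  rw [dist_eq_norm]
  exact norm_le_of_forall_abs_le _ (by positivity) fun i => hx i

theorem cubeQ_subset_closedBall (k : ℤ) (z : Fin n → ℤ) :
    cubeQ k z ⊆ closedBall (cubeCenter k z) (n * ((2:ℝ) ^ (-k) / 2)) := by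
  intro x hx
  have := dist_cubeCenter_le (K := 1) zero_le_one k z (x := x) (fun i => by simpa using hx i)
  simpa using this

theorem diam_cubeQ_le (k : ℤ) (z : Fin n → ℤ) :
    Metric.diam (cubeQ k z) ≤ n * (2:ℝ) ^ (-k) := by
  refine (Metric.diam_mono (cubeQ_subset_closedBall k z) isBounded_closedBall).trans ?_
  refine (Metric.diam_closedBall (by positivity)).trans (le_of_eq ?_)
  ring

theorem le_diam_cubeQ (hn : n ≠ 0) (k : ℤ) (z : Fin n → ℤ) :
    (2:ℝ) ^ (-k) ≤ Metric.diam (cubeQ k z) := by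
  have hs : (0:ℝ) < 2 ^ (-k) := by positivity
  let e : ℝ → Eucl n := fun c => WithLp.toLp 2 fun i => (z i : ℝ) * (2:ℝ) ^ (-k) + c
  have hmem : ∀ c ∈ Icc (0:ℝ) (2 ^ (-k)), e c ∈ cubeQ k z := by
    intro c hc i
    simp only [e]
    rw [abs_le]
    constructor <;> linarith [hc.1, hc.2]
  have h1 := Metric.dist_le_diam_of_mem
    (isBounded_closedBall.subset (cubeQ_subset_closedBall k z))
    (hmem (2 ^ (-k)) ⟨hs.le, le_rfl⟩) (hmem 0 ⟨le_rfl, hs.le⟩)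
  refine le_trans ?_ h1
  rw [dist_eq_norm]
  have h2 := PiLp.norm_apply_le (e (2 ^ (-k)) - e 0) ⟨0, Nat.pos_of_ne_zero hn⟩
  refine le_trans ?_ h2
  simp [e]

theorem WhitneyTreeCovering.cubeO_subset {Ω : Set (Eucl n)} (T : WhitneyTreeCovering n Ω)
    (t : T.ι) : cubeO (T.kk t) (T.zz t) ⊆ Ω :=
  (cubeO_subset_cubeQ _ _).trans
    ((subset_iUnion (fun t => cubeQ (T.kk t) (T.zz t)) t).trans T.unionQ.subset)

theorem bdist_cubeCenter_bounds (hn : n ≠ 0) {Ω : Set (Eucl n)} (T : WhitneyTreeCovering n Ω)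
    (t : T.ι) :
    (2:ℝ) ^ (-T.kk t) ≤ bdist Ω (cubeCenter (T.kk t) (T.zz t)) ∧
      bdist Ω (cubeCenter (T.kk t) (T.zz t)) ≤ 5 * n * (2:ℝ) ^ (-T.kk t) := by
  set k := T.kk t
  set z := T.zz t
  have hs : (0:ℝ) < 2 ^ (-k) := by positivity
  have h1 : Metric.diam (cubeQ k z) ≤ setDist (cubeQ k z) (frontier Ω) := T.whitney₁ t
  have h2 : setDist (cubeQ k z) (frontier Ω) ≤ 4 * Metric.diam (cubeQ k z) := T.whitney₂ t
  have h3 := le_diam_cubeQ hn k z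
  have h4 := diam_cubeQ_le k z
  have hne : (frontier Ω).Nonempty := by
    rw [Set.nonempty_iff_ne_empty]
    intro h
    simp only [h, setDist, Set.image2_empty_right, Real.sInf_empty] at h1
    linarith
  have hbdd : BddBelow (Set.image2 dist (cubeQ k z) (frontier Ω)) := by
    refine ⟨0, ?_⟩
    rintro _ ⟨a, -, b, -, rfl⟩
    exact dist_nonneg
  constructor
  · refine h3.trans (h1.trans ?_)
    rw [bdist]
    refine (Metric.le_infDist hne).2 fun y hy => csInf_le hbdd ?_
    exact ⟨_, cubeCenter_mem_cubeQ k z, y, hy, rfl⟩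
  · have h5 : bdist Ω (cubeCenter k z) - n * ((2:ℝ) ^ (-k) / 2)
        ≤ setDist (cubeQ k z) (frontier Ω) := by
      refine le_csInf (Set.Nonempty.image2 ⟨_, cubeCenter_mem_cubeQ k z⟩ hne) ?_
      rintro _ ⟨a, ha, b, hb, rfl⟩
      have e1 : bdist Ω (cubeCenter k z) ≤ dist (cubeCenter k z) b := Metric.infDist_le_dist_of_mem hb
      have e2 := dist_triangle (cubeCenter k z) a b
      have e3 : dist a (cubeCenter k z) ≤ n * ((2:ℝ) ^ (-k) / 2) := cubeQ_subset_closedBall k z ha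
      rw [dist_comm] at e3
      linarith
    have : (0:ℝ) ≤ n * (2:ℝ) ^ (-k) := by positivity
    linarith

/-- Boundary log-Hölder exponents are almost constant on dilated Whitney cubes. -/
theorem exists_local_exponent {K : ℝ} (hK : 1 < K) {Ω : Set (Eucl n)}
    (hΩ : volume Ω ≠ ⊤) (T : WhitneyTreeCovering n Ω) {q : Eucl n → ℝ} {p Qp C₀ : ℝ}
    (hp : 0 < p) (hpQ : p ≤ Qp)
    (hq : ∀ᵐ x ∂(volume.restrict Ω), p ≤ q x ∧ q x ≤ Qp) (hC₀ : 0 < C₀)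
    (hLH : BoundaryLH Ω q (K * (n + 1)) C₀) :
    ∃ L : ℝ, 1 ≤ L ∧ ∃ m : T.ι → ℝ, ∀ t, p ≤ m t ∧ m t ≤ Qp ∧
      ∀ᵐ x ∂(volume.restrict Ω), x ∈ cubeDil K (T.kk t) (T.zz t) →
        m t ≤ q x ∧ cubeVol n (T.kk t) ^ (q x - m t) ≤ L ∧
          cubeVol n (T.kk t) ^ (-(q x - m t)) ≤ L := by
  set τ : ℝ := K * (n + 1) with hτ
  have hτ1 : 1 ≤ τ := by
    have : (0:ℝ) ≤ n := by positivity
    nlinarith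
  set W : ℝ := max 1 (volume Ω).toReal with hW
  set D : ℝ := 10 * n * τ + 1 with hD
  have hD1 : 1 ≤ D := by
    have : 0 ≤ 10 * n * τ := by positivity
    linarith
  have hW1 : 1 ≤ W := le_max_left _ _
  have hQ0 : 0 ≤ Qp := by linarith
  have hA1 : 1 ≤ W ^ Qp := Real.one_le_rpow hW1 hQ0
  have hB1 : 1 ≤ D ^ (n * Qp) := Real.one_le_rpow hD1 (by positivity)
  have hE1 : 1 ≤ Real.exp (n * C₀) := Real.one_le_exp (by positivity)
  have hBE : 1 ≤ D ^ (n * Qp) * Real.exp (n * C₀) := one_le_mul_of_one_le_of_one_le hB1 hE1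
  refine ⟨W ^ Qp + D ^ (n * Qp) * Real.exp (n * C₀), by linarith, ?_⟩
  suffices h : ∀ t : T.ι, ∃ m : ℝ, p ≤ m ∧ m ≤ Qp ∧
      ∀ᵐ x ∂(volume.restrict Ω), x ∈ cubeDil K (T.kk t) (T.zz t) →
        m ≤ q x ∧ cubeVol n (T.kk t) ^ (-(q x - m)) ≤ D ^ (n * Qp) * Real.exp (n * C₀) by
    choose m hm using h
    refine ⟨m, fun t => ⟨(hm t).1, (hm t).2.1, ?_⟩⟩
    filter_upwards [(hm t).2.2, hq] with x hx hqx hxK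
    obtain ⟨hx1, hx2⟩ := hx hxK
    refine ⟨hx1, ?_, by linarith⟩
    have hle : cubeVol n (T.kk t) ≤ W := by
      refine le_trans ?_ (le_max_right _ _)
      have := measure_mono (μ := volume) (T.cubeO_subset t)
      rw [volume_cubeO] at this
      exact (ENNReal.ofReal_le_iff_le_toReal hΩ).1 this
    have := (Real.rpow_le_rpow (cubeVol_pos _).le hle (sub_nonneg.2 hx1)).trans
      (Real.rpow_le_rpow_of_exponent_le hW1 (by linarith [(hm t).1] : q x - m t ≤ Qp))
    linarith
  intro t
  set s : ℝ := (2:ℝ) ^ (-T.kk t) with hs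
  have hs0 : 0 < s := by positivity
  have hvol : ∀ θ : ℝ, cubeVol n (T.kk t) ^ (-θ) = (s⁻¹) ^ (n * θ) := by
    intro θ
    rw [cubeVol, ← hs, ← Real.rpow_natCast, ← Real.rpow_mul hs0.le, Real.inv_rpow hs0.le,
      ← Real.rpow_neg hs0.le]
    congr 1
    ring
  by_cases hn : n = 0
  · refine ⟨p, le_rfl, hpQ, ?_⟩
    filter_upwards [hq] with x hx _
    refine ⟨hx.1, ?_⟩
    rw [hvol]
    simp only [hn, Nat.cast_zero, zero_mul, Real.rpow_zero, Real.exp_zero, mul_one]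
    exact le_rfl
  obtain ⟨hd1, hd2⟩ := bdist_cubeCenter_bounds hn T t
  rw [← hs] at hd1 hd2
  set x₀ := cubeCenter (T.kk t) (T.zz t) with hx₀
  set u : ℝ := τ * bdist Ω x₀ with hu
  have hn1 : (1:ℝ) ≤ n := by exact_mod_cast Nat.one_le_iff_ne_zero.2 hn
  have hu0 : 0 < u := by
    have : 0 < bdist Ω x₀ := by linarith
    positivity
  have hus : 2 * u ≤ D * s := by
    have : τ * bdist Ω x₀ ≤ τ * (5 * n * s) := by gcongr
    rw [hD, hu]
    nlinarith
  by_cases hbig : 1 / 2 < u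
  · refine ⟨p, le_rfl, hpQ, ?_⟩
    filter_upwards [hq] with x hx _
    refine ⟨hx.1, ?_⟩
    rw [hvol]
    have hsD : s⁻¹ ≤ D := by
      rw [inv_le_iff_one_le_mul₀ hs0]
      linarith
    calc (s⁻¹) ^ (n * (q x - p)) ≤ D ^ (n * (q x - p)) := by
          refine Real.rpow_le_rpow (by positivity) hsD ?_
          have : 0 ≤ q x - p := by linarith [hx.1]
          positivity
      _ ≤ D ^ (n * Qp) := by
          refine Real.rpow_le_rpow_of_exponent_le hD1 ?_
          gcongr
          linarith [hx.2]
      _ ≤ D ^ (n * Qp) * Real.exp (n * C₀) := le_mul_of_one_le_right (by positivity) hE1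
  have hu12 : u ≤ 1 / 2 := not_lt.1 hbig
  have hx₀Ω : x₀ ∈ Ω := by
    rw [← T.unionQ]
    exact mem_iUnion.2 ⟨t, cubeCenter_mem_cubeQ _ _⟩
  have hosc := hLH x₀ hx₀Ω hu12
  set R := ballB Ω τ x₀ ∩ Ω with hR
  have hqR : ∀ᵐ x ∂(volume.restrict R), p ≤ q x ∧ q x ≤ Qp :=
    ae_restrict_of_ae_restrict_of_subset inter_subset_right hq
  have hlow : ∀ᵐ x ∂(volume.restrict R), essInfOn q R ≤ q x :=
    ae_essInf_le ⟨p, Filter.eventually_map.2 (hqR.mono fun x hx => hx.1)⟩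
  have hupp : ∀ᵐ x ∂(volume.restrict R), q x ≤ essSupOn q R :=
    ae_le_essSup ⟨Qp, Filter.eventually_map.2 (hqR.mono fun x hx => hx.2)⟩
  set i₀ := essInfOn q R
  set s₀ := essSupOn q R
  refine ⟨min Qp (max p i₀), le_min hpQ (le_max_left _ _), min_le_left _ _, ?_⟩
  have hKR : cubeDil K (T.kk t) (T.zz t) ⊆ ballB Ω τ x₀ := by
    intro x hx
    have h1 := dist_cubeCenter_le (by linarith : 0 ≤ K) _ _ hx
    rw [ballB, mem_ball]
    refine lt_of_le_of_lt h1 ?_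
    rw [← hs]
    have : τ * s ≤ τ * bdist Ω x₀ := by gcongr
    refine lt_of_lt_of_le ?_ this
    rw [hτ]
    have : 0 < K * s := by positivity
    nlinarith
  have hbm : MeasurableSet (ballB Ω τ x₀) := measurableSet_ball
  have hRr : (volume.restrict Ω).restrict (ballB Ω τ x₀) = volume.restrict R :=
    Measure.restrict_restrict hbm
  have hall : ∀ᵐ x ∂(volume.restrict R), i₀ ≤ q x ∧ q x ≤ s₀ := hlow.and hupp
  rw [← hRr, ae_restrict_iff' hbm] at hall
  filter_upwards [hall, hq] with x hx hqx hxK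
  obtain ⟨hx1, hx2⟩ := hx (hKR hxK)
  have hmq : min Qp (max p i₀) ≤ q x := (min_le_right _ _).trans (max_le hqx.1 hx1)
  refine ⟨hmq, ?_⟩
  set θ := q x - min Qp (max p i₀) with hθ
  have hθ0 : 0 ≤ θ := sub_nonneg.2 hmq
  have hθQ : θ ≤ Qp := by
    have : p ≤ min Qp (max p i₀) := le_min hpQ (le_max_left _ _)
    linarith [hqx.2]
  have hθo : θ ≤ s₀ - i₀ := by
    rcases min_choice Qp (max p i₀) with h | h
    · rw [hθ, h]
      linarith [hqx.2]
    · rw [hθ, h]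
      linarith [le_max_right p i₀]
  have hlog : 0 < -Real.log u := by
    have := Real.log_neg hu0 (by linarith)
    linarith
  have hθC : θ * (-Real.log u) ≤ C₀ := by
    have := hθo.trans hosc
    rwa [le_div_iff₀ hlog] at this
  rw [hvol]
  have hsD : s⁻¹ ≤ D * u⁻¹ := by
    rw [← div_eq_mul_inv, le_div_iff₀ hu0, inv_mul_le_iff₀ hs0]
    nlinarith
  calc (s⁻¹) ^ (n * θ) ≤ (D * u⁻¹) ^ (n * θ) := Real.rpow_le_rpow (by positivity) hsD (by positivity)
    _ = D ^ (n * θ) * (u⁻¹) ^ (n * θ) := Real.mul_rpow (by positivity) (by positivity)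
    _ ≤ D ^ (n * Qp) * Real.exp (n * C₀) := by
        gcongr
        rw [Real.rpow_def_of_pos (by positivity), Real.log_inv]
        refine Real.exp_le_exp.2 ?_
        calc -Real.log u * (n * θ) = n * (θ * (-Real.log u)) := by ring
          _ ≤ n * C₀ := by gcongr

end Cubes

/-! ### The decomposition attached to a tree covering -/

namespace WhitneyTreeCovering

variable {n : ℕ} {Ω : Set (Eucl n)} (T : WhitneyTreeCovering n Ω)

/-- The open Whitney cube. -/
def P (t : T.ι) : Set (Eucl n) := cubeO (T.kk t) (T.zz t)

/-- The number of generations between an index and the root. -/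
def depth : T.ι → ℕ := Classical.choose (exists_depth T.parent T.root T.reach)

theorem depth_root : T.depth T.root = 0 :=
  (Classical.choose_spec (exists_depth T.parent T.root T.reach)).1

theorem depth_parent : ∀ c, c ≠ T.root → T.depth c = T.depth (T.parent c) + 1 :=
  (Classical.choose_spec (exists_depth T.parent T.root T.reach)).2

/-- The union of the open Whitney cubes below `t`. -/
def E (t : T.ι) : Set (Eucl n) := ⋃ s ∈ treeDesc T.parent T.depth t, T.P s

/-- The children of `t`. -/
abbrev children (t : T.ι) : Set T.ι := treeChildren T.parent T.root t

theorem P_subset (t : T.ι) : T.P t ⊆ Ω := T.cubeO_subset t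

theorem measurableSet_P (t : T.ι) : MeasurableSet (T.P t) := (isOpen_cubeO _ _).measurableSet

theorem P_subset_U (t : T.ι) : T.P t ⊆ T.U t := cubeO_subset_cubeU _ _

theorem disjoint_P {s t : T.ι} (h : s ≠ t) : Disjoint (T.P s) (T.P t) :=
  (T.disjQ s t h).mono (interior_maximal (cubeO_subset_cubeQ _ _) (isOpen_cubeO _ _))
    (interior_maximal (cubeO_subset_cubeQ _ _) (isOpen_cubeO _ _))

theorem volume_P (t : T.ι) : volume (T.P t) = ENNReal.ofReal (cubeVol n (T.kk t)) :=
  volume_cubeO _ _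

theorem isOpen_E (t : T.ι) : IsOpen (T.E t) :=
  isOpen_biUnion fun _ _ => isOpen_cubeO _ _

theorem measurableSet_E (t : T.ι) : MeasurableSet (T.E t) := (T.isOpen_E t).measurableSet

theorem E_subset (t : T.ι) : T.E t ⊆ Ω := iUnion₂_subset fun s _ => T.P_subset s

theorem ae_mem_iUnion_P : ∀ᵐ x ∂(volume.restrict Ω), ∃ t, x ∈ T.P t := by
  have := T.countable
  have h : volume (⋃ t, (cubeQ (T.kk t) (T.zz t) \ cubeO (T.kk t) (T.zz t))) = 0 :=
    measure_iUnion_null fun t => volume_cubeQ_diff_cubeO _ _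
  have h1 : ∀ᵐ x ∂(volume.restrict Ω),
      x ∉ ⋃ t, (cubeQ (T.kk t) (T.zz t) \ cubeO (T.kk t) (T.zz t)) :=
    ae_restrict_of_ae (measure_eq_zero_iff_ae_notMem.1 h)
  have h2 : ∀ᵐ x ∂(volume.restrict Ω), x ∈ Ω := by
    refine ae_restrict_mem ?_
    rw [← T.unionQ]
    refine MeasurableSet.iUnion fun t => ?_
    have : cubeQ (T.kk t) (T.zz t) = ⋂ i, {x : Eucl n |
        |x i - ((T.zz t i : ℝ) + 1 / 2) * (2:ℝ) ^ (-T.kk t)| ≤ (2:ℝ) ^ (-T.kk t) / 2} := by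
      ext x
      simp [cubeQ]
    rw [this]
    exact MeasurableSet.iInter fun i => measurableSet_le (by fun_prop) measurable_const
  filter_upwards [h1, h2] with x hx hxΩ
  have hxQ : x ∈ ⋃ t, cubeQ (T.kk t) (T.zz t) := T.unionQ.symm.subset hxΩ
  obtain ⟨t, ht⟩ := mem_iUnion.1 hxQ
  refine ⟨t, ?_⟩
  by_contra hxt
  exact hx (mem_iUnion.2 ⟨t, ht, hxt⟩)

theorem E_root_ae_eq : T.E T.root =ᵐ[volume.restrict Ω] (univ : Set (Eucl n)) := by
  refine eventuallyEq_univ.2 ?_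
  filter_upwards [T.ae_mem_iUnion_P] with x hx
  obtain ⟨t, ht⟩ := hx
  refine mem_iUnion₂.2 ⟨t, ?_, ht⟩
  rw [treeDesc_root T.depth_root T.depth_parent]
  trivial

theorem setIntegral_E_root (g : Eucl n → ℝ) : ∫ x in T.E T.root, g x = ∫ x in Ω, g x := by
  have h1 : volume.restrict (T.E T.root) = (volume.restrict Ω).restrict (T.E T.root) := by
    rw [Measure.restrict_restrict (T.measurableSet_E _),
      inter_eq_self_of_subset_left (T.E_subset _)]
  rw [h1, Measure.restrict_congr_set T.E_root_ae_eq, Measure.restrict_univ]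

theorem E_eq (t : T.ι) : T.E t = T.P t ∪ ⋃ c : T.children t, T.E c := by
  ext x
  simp only [E, mem_iUnion, mem_union, exists_prop,
    treeDesc_eq T.depth_root T.depth_parent t, mem_singleton_iff, Subtype.exists]
  constructor
  · rintro ⟨s, rfl | ⟨c, hc, hs⟩, hx⟩
    · exact Or.inl hx
    · exact Or.inr ⟨c, hc, s, hs, hx⟩
  · rintro (hx | ⟨c, hc, s, hs, hx⟩)
    · exact ⟨t, Or.inl rfl, hx⟩
    · exact ⟨s, Or.inr ⟨c, hc, hs⟩, hx⟩

theorem disjoint_biUnion_P {I J : Set T.ι} (h : Disjoint I J) :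
    Disjoint (⋃ s ∈ I, T.P s) (⋃ s ∈ J, T.P s) := by
  simp only [Set.disjoint_iUnion_left, Set.disjoint_iUnion_right]
  intro i hi j hj
  refine T.disjoint_P ?_
  rintro rfl
  exact Set.disjoint_left.1 h hj hi

theorem disjoint_E_children (t : T.ι) :
    Pairwise (Function.onFun Disjoint fun c : T.children t => T.E c) := fun c c' hcc' =>
  T.disjoint_biUnion_P (disjoint_treeDesc_children T.depth_parent c.2 c'.2
    fun h => hcc' (Subtype.ext h))

theorem disjoint_P_iUnion_E (t : T.ι) : Disjoint (T.P t) (⋃ c : T.children t, T.E c) := by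
  refine Set.disjoint_iUnion_right.2 fun c => ?_
  have := T.disjoint_biUnion_P (I := {t}) (J := treeDesc T.parent T.depth c)
    (Set.disjoint_singleton_left.2 (notMem_treeDesc_child T.depth_parent c.2))
  simpa [E] using this

theorem hasSum_setIntegral_E {g : Eucl n → ℝ} (hg : IntegrableOn g Ω) (t : T.ι) :
    HasSum (fun c : T.children t => ∫ x in T.E c, g x)
      ((∫ x in T.E t, g x) - ∫ x in T.P t, g x) := by
  have := T.countable
  have hsub : (⋃ c : T.children t, T.E c) ⊆ Ω := iUnion_subset fun c => T.E_subset _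
  have hm : MeasurableSet (⋃ c : T.children t, T.E c) :=
    MeasurableSet.iUnion fun c => T.measurableSet_E _
  rw [T.E_eq t, setIntegral_union (T.disjoint_P_iUnion_E t) hm (hg.mono_set (T.P_subset t))
    (hg.mono_set hsub), add_sub_cancel_left]
  exact hasSum_integral_iUnion (fun c => T.measurableSet_E _) (T.disjoint_E_children t)
    (hg.mono_set hsub)

theorem cubeVol_le_mul_volume_Bt {t : T.ι} (ht : t ≠ T.root) :
    cubeVol n (T.kk t) ≤ T.C₂ * (volume (T.Bt t)).toReal := by
  refine le_trans ?_ (T.meas_ratio t ht)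
  rw [volume_cubeU, ENNReal.toReal_ofReal (by have := cubeVol_pos (n := n) (T.kk t); positivity)]
  exact le_mul_of_one_le_left (cubeVol_pos _).le (one_le_pow₀ (by norm_num))

theorem volume_Bt_toReal_pos {t : T.ι} (ht : t ≠ T.root) : 0 < (volume (T.Bt t)).toReal := by
  have h := T.cubeVol_le_mul_volume_Bt ht
  have h' := cubeVol_pos (n := n) (T.kk t)
  refine ENNReal.toReal_nonneg.lt_of_ne fun h0 => ?_
  rw [← h0, mul_zero] at h
  linarith

theorem volume_Bt_ne_top {t : T.ι} (ht : t ≠ T.root) : volume (T.Bt t) ≠ ⊤ := by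
  intro h
  have := T.volume_Bt_toReal_pos ht
  simp [h] at this

/-- The function carrying the mass of `g` below `t` on the bridge between `t` and its parent. -/
def bridge (g : Eucl n → ℝ) (t : T.ι) : Eucl n → ℝ :=
  (T.Bt t).indicator fun _ => (∫ x in T.E t, g x) / (volume (T.Bt t)).toReal

/-- The sum of the bridges to the children of `t`. -/
def childBridges (g : Eucl n → ℝ) (t : T.ι) (x : Eucl n) : ℝ :=
  ∑' c : T.children t, T.bridge g c x

open Classical in
/-- The bridge to the parent, which vanishes at the root. -/
def parentBridge (g : Eucl n → ℝ) (t : T.ι) (x : Eucl n) : ℝ :=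
  if t = T.root then 0 else T.bridge g t x

/-- The mean-zero pieces of `g`. -/
def decomp (g : Eucl n → ℝ) (t : T.ι) (x : Eucl n) : ℝ :=
  (T.P t).indicator g x + T.childBridges g t x - T.parentBridge g t x

theorem decomp_div (g : Eucl n → ℝ) (l : ℝ) (t : T.ι) (x : Eucl n) :
    T.decomp (fun y => g y / l) t x = T.decomp g t x / l := by
  have hb : ∀ s, T.bridge (fun y => g y / l) s x = T.bridge g s x / l := by
    intro s
    by_cases hx : x ∈ T.Bt s
    · simp only [bridge, Set.indicator_of_mem hx, integral_div]
      ring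
    · simp [bridge, hx]
  have hP : (T.P t).indicator (fun y => g y / l) x = (T.P t).indicator g x / l := by
    by_cases hx : x ∈ T.P t <;> simp [hx]
  simp only [decomp, childBridges, parentBridge, hb, hP, tsum_div_const]
  split_ifs <;> ring

theorem bridge_eq_zero {g : Eucl n → ℝ} {s : T.ι} {x : Eucl n} (hx : x ∉ T.Bt s) :
    T.bridge g s x = 0 := Set.indicator_of_notMem hx _

theorem eq_of_mem_Bt {s t : T.ι} (hs : s ≠ T.root) (ht : t ≠ T.root) {x : Eucl n}
    (hxs : x ∈ T.Bt s) (hxt : x ∈ T.Bt t) : s = t := by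
  by_contra h
  exact Set.disjoint_left.1 (T.Bt_disj s t hs ht h) hxs hxt

theorem childBridges_eq (g : Eucl n → ℝ) {t : T.ι} (c : T.children t) {x : Eucl n}
    (hx : x ∈ T.Bt c) : T.childBridges g t x = T.bridge g c x := by
  refine tsum_eq_single c fun c' hc' => T.bridge_eq_zero fun hx' => hc' ?_
  exact Subtype.ext (T.eq_of_mem_Bt c'.2.1 c.2.1 hx' hx)

theorem childBridges_eq_zero (g : Eucl n → ℝ) {t : T.ι} {x : Eucl n}
    (hx : ∀ c : T.children t, x ∉ T.Bt c) : T.childBridges g t x = 0 := by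
  have : ∀ c : T.children t, T.bridge g c x = 0 := fun c => T.bridge_eq_zero (hx c)
  simp [childBridges, this]

theorem support_decomp_subset (g : Eucl n → ℝ) (t : T.ι) :
    Function.support (T.decomp g t) ⊆ T.U t := by
  intro x hx
  by_contra hxU
  refine hx ?_
  have h1 : x ∉ T.P t := fun h => hxU (T.P_subset_U t h)
  have h2 : T.childBridges g t x = 0 := by
    refine T.childBridges_eq_zero g fun c hc => hxU ?_
    have := (T.Bt_sub c c.2.1 hc).2
    rwa [c.2.2] at this
  have h3 : T.parentBridge g t x = 0 := by
    rw [parentBridge]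
    split_ifs with ht
    · rfl
    · exact T.bridge_eq_zero fun h => hxU (T.Bt_sub t ht h).1
  simp [decomp, h1, h2, h3]

theorem integrable_bridge (g : Eucl n → ℝ) {t : T.ι} (ht : t ≠ T.root) :
    Integrable (T.bridge g t) :=
  (integrable_indicator_iff (T.Bt_open t).measurableSet).2
    (integrableOn_const (T.volume_Bt_ne_top ht))

theorem setIntegral_Bt_bridge (g : Eucl n → ℝ) {t : T.ι} (ht : t ≠ T.root) :
    ∫ x in T.Bt t, T.bridge g t x = ∫ x in T.E t, g x := by
  have h := T.volume_Bt_toReal_pos ht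
  rw [setIntegral_congr_fun (g := fun _ => (∫ x in T.E t, g x) / (volume (T.Bt t)).toReal)
    (T.Bt_open t).measurableSet (fun x hx => Set.indicator_of_mem hx _), setIntegral_const,
    Measure.real, smul_eq_mul]
  field_simp

theorem integral_bridge (g : Eucl n → ℝ) {t : T.ι} (ht : t ≠ T.root) :
    ∫ x, T.bridge g t x = ∫ x in T.E t, g x := by
  rw [← T.setIntegral_Bt_bridge g ht]
  exact (setIntegral_eq_integral_of_forall_compl_eq_zero fun x hx => T.bridge_eq_zero hx).symm

theorem integrable_childBridges {g : Eucl n → ℝ} (hg : IntegrableOn g Ω) (t : T.ι) :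
    Integrable (T.childBridges g t) ∧
      ∫ x, T.childBridges g t x = (∫ x in T.E t, g x) - ∫ x in T.P t, g x := by
  have := T.countable
  have hm : ∀ c : T.children t, MeasurableSet (T.Bt c) := fun c => (T.Bt_open c).measurableSet
  have heq : ∀ c : T.children t, EqOn (T.childBridges g t) (T.bridge g c) (T.Bt c) :=
    fun c x hx => T.childBridges_eq g c hx
  have hint : ∀ c : T.children t, IntegrableOn (T.childBridges g t) (T.Bt c) := fun c =>
    (T.integrable_bridge g c.2.1).integrableOn.congr_fun (heq c).symm (hm c)
  have hzero : ∀ x ∉ ⋃ c : T.children t, T.Bt c, T.childBridges g t x = 0 := fun x hx =>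
    T.childBridges_eq_zero g fun c hc => hx (mem_iUnion.2 ⟨c, hc⟩)
  have hsum : Summable fun c : T.children t => ∫ x in T.Bt c, ‖T.childBridges g t x‖ := by
    refine Summable.of_nonneg_of_le (fun c => integral_nonneg fun x => norm_nonneg _) (fun c => ?_)
      (T.hasSum_setIntegral_E hg.norm t).summable
    have h := T.volume_Bt_toReal_pos c.2.1
    rw [setIntegral_congr_fun (g := fun _ => ‖(∫ x in T.E c, g x)‖ / (volume (T.Bt c)).toReal)
      (hm c) ?_, setIntegral_const, Measure.real, smul_eq_mul]
    · rw [mul_div_cancel₀ _ h.ne']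
      exact norm_integral_le_integral_norm _
    · intro x hx
      simp only [heq c hx, bridge, Set.indicator_of_mem hx, norm_div, Real.norm_eq_abs,
        abs_of_pos h]
  have hon : IntegrableOn (T.childBridges g t) (⋃ c : T.children t, T.Bt c) :=
    integrableOn_iUnion_of_summable_integral_norm hint hsum
  refine ⟨(integrableOn_iff_integrable_of_support_subset ?_).1 hon, ?_⟩
  · intro x hx
    by_contra h
    exact hx (hzero x h)
  · rw [← setIntegral_eq_integral_of_forall_compl_eq_zero hzero]
    have hdisj : Pairwise (Function.onFun Disjoint fun c : T.children t => T.Bt c) :=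
      fun c c' hcc' => T.Bt_disj c c' c.2.1 c'.2.1 fun h => hcc' (Subtype.ext h)
    have hfun : (fun c : T.children t => ∫ x in T.Bt c, T.childBridges g t x) =
        fun c : T.children t => ∫ x in T.E c, g x := by
      ext c
      rw [setIntegral_congr_fun (hm c) (heq c), T.setIntegral_Bt_bridge g c.2.1]
    have h := hasSum_integral_iUnion hm hdisj hon
    rw [hfun] at h
    exact h.unique (T.hasSum_setIntegral_E hg t)

theorem integrable_parentBridge (g : Eucl n → ℝ) (t : T.ι) :
    Integrable (T.parentBridge g t) := by
  by_cases ht : t = T.root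
  · have : T.parentBridge g t = fun _ => 0 := by
      ext x
      simp [parentBridge, ht]
    rw [this]
    exact integrable_zero _ _ _
  · have : T.parentBridge g t = T.bridge g t := by
      ext x
      simp [parentBridge, ht]
    rw [this]
    exact T.integrable_bridge g ht

theorem integral_parentBridge {g : Eucl n → ℝ} (h0 : ∫ x in Ω, g x = 0) (t : T.ι) :
    ∫ x, T.parentBridge g t x = ∫ x in T.E t, g x := by
  by_cases ht : t = T.root
  · simp [parentBridge, ht, T.setIntegral_E_root, h0]
  · simpa [parentBridge, ht] using T.integral_bridge g ht

theorem integrable_indicator_P {g : Eucl n → ℝ} (hg : IntegrableOn g Ω) (t : T.ι) :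
    Integrable ((T.P t).indicator g) :=
  (integrable_indicator_iff (T.measurableSet_P t)).2 (hg.mono_set (T.P_subset t))

theorem integrable_decomp {g : Eucl n → ℝ} (hg : IntegrableOn g Ω) (t : T.ι) :
    Integrable (T.decomp g t) :=
  ((T.integrable_indicator_P hg t).add (T.integrable_childBridges hg t).1).sub
    (T.integrable_parentBridge g t)

theorem integral_decomp {g : Eucl n → ℝ} (hg : IntegrableOn g Ω) (h0 : ∫ x in Ω, g x = 0)
    (t : T.ι) : ∫ x in T.U t, T.decomp g t x = 0 := by
  rw [setIntegral_eq_integral_of_forall_compl_eq_zero fun x hx => by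
    by_contra h
    exact hx (T.support_decomp_subset g t h)]
  have hc := T.integrable_childBridges hg t
  simp only [decomp]
  have h1 := integral_sub ((T.integrable_indicator_P hg t).add hc.1) (T.integrable_parentBridge g t)
  have h2 := integral_add (T.integrable_indicator_P hg t) hc.1
  simp only [Pi.add_apply] at h1
  rw [h1, h2, hc.2, T.integral_parentBridge h0, integral_indicator (T.measurableSet_P t)]
  ring

theorem ae_eq_tsum_decomp (g : Eucl n → ℝ) :
    ∀ᵐ x ∂(volume.restrict Ω), g x = ∑' t, T.decomp g t x := by
  filter_upwards [T.ae_mem_iUnion_P] with x ⟨t₀, ht₀⟩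
  have hP : HasSum (fun t => (T.P t).indicator g x) (g x) := by
    have := hasSum_single (f := fun t => (T.P t).indicator g x) t₀ fun t ht =>
      Set.indicator_of_notMem (fun h => Set.disjoint_left.1 (T.disjoint_P ht) h ht₀) _
    simpa [Set.indicator_of_mem ht₀] using this
  have hB : ∃ b, HasSum (fun t => T.childBridges g t x) b ∧
      HasSum (fun t => T.parentBridge g t x) b := by
    by_cases h : ∃ s, s ≠ T.root ∧ x ∈ T.Bt s
    · obtain ⟨s, hs, hxs⟩ := h
      refine ⟨T.bridge g s x, ?_, ?_⟩
      · have h1 := hasSum_single (f := fun t => T.childBridges g t x) (T.parent s) fun t ht =>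
          T.childBridges_eq_zero g fun c hc => ht <| by
            rw [← T.eq_of_mem_Bt c.2.1 hs hc hxs]
            exact c.2.2.symm
        rwa [T.childBridges_eq g (⟨s, hs, rfl⟩ : T.children (T.parent s)) hxs] at h1
      · have h1 := hasSum_single (f := fun t => T.parentBridge g t x) s fun t ht => by
          rw [parentBridge]
          split_ifs with htr
          · rfl
          · exact T.bridge_eq_zero fun h => ht (T.eq_of_mem_Bt htr hs h hxs)
        simpa [parentBridge, hs] using h1
    · push Not at h
      refine ⟨0, ?_, ?_⟩
      · have : (fun t => T.childBridges g t x) = fun _ => 0 :=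
          funext fun t => T.childBridges_eq_zero g fun c => h c c.2.1
        rw [this]
        exact hasSum_zero
      · have : (fun t => T.parentBridge g t x) = fun _ => 0 := by
          ext t
          rw [parentBridge]
          split_ifs with htr
          · rfl
          · exact T.bridge_eq_zero (h t htr)
        rw [this]
        exact hasSum_zero
  obtain ⟨b, hb1, hb2⟩ := hB
  have := ((hP.add hb1).sub hb2).tsum_eq
  rw [add_sub_cancel_right] at this
  exact this.symm

end WhitneyTreeCovering

/-! ### Modular estimates -/

/-- The modular of the variable Lebesgue space. -/
def modular {n : ℕ} (A : Set (Eucl n)) (q f : Eucl n → ℝ) : ENNReal :=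
  ∫⁻ x in A, ENNReal.ofReal (|f x| ^ q x)

theorem le_add_rpow_mul_rpow {v y m : ℝ} (hv : 0 ≤ v) (hy : 0 < y) (hm : 1 ≤ m) :
    v ≤ y + y ^ (1 - m) * v ^ m := by
  rcases le_or_gt v y with h | h
  · have : 0 ≤ y ^ (1 - m) * v ^ m := by positivity
    linarith
  · have hv0 : 0 < v := hy.trans h
    have h1 : v ^ (1 - m) ≤ y ^ (1 - m) :=
      Real.rpow_le_rpow_of_nonpos hy h.le (by linarith)
    have h2 : v ^ (1 - m) * v ^ m = v := by
      rw [← Real.rpow_add hv0]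
      simp
    nlinarith [Real.rpow_pos_of_pos hv0 m]

theorem rpow_le_one_add_rpow {v m q : ℝ} (hv : 0 ≤ v) (hm : 0 ≤ m) (hmq : m ≤ q) :
    v ^ m ≤ 1 + v ^ q := by
  have hq : 0 ≤ v ^ q := Real.rpow_nonneg hv q
  rcases le_or_gt v 1 with h | h
  · have := Real.rpow_le_one hv h hm
    linarith
  · have := Real.rpow_le_rpow_of_exponent_le h.le hmq
    linarith

theorem lintegral_one_add_le {n : ℕ} {Ω : Set (Eucl n)} {q g : Eucl n → ℝ}
    (hg : modular Ω q g ≤ 1) :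
    ∫⁻ x in Ω, (1 + ENNReal.ofReal (|g x| ^ q x)) ≤ volume Ω + 1 := by
  rw [lintegral_add_left measurable_const, lintegral_const, Measure.restrict_apply_univ, one_mul]
  exact add_le_add le_rfl hg

namespace WhitneyTreeCovering

variable {n : ℕ} {Ω : Set (Eucl n)} (T : WhitneyTreeCovering n Ω)

/-- The exponent `q` is comparable on `K Q_t` to the constant `m t`, uniformly in `t`, and the
shadows of the covering are controlled by the dilated cubes. -/
structure ControlsExponent (q : Eucl n → ℝ) (K p Qp L : ℝ) (m : T.ι → ℝ) : Prop where
  one_lt_K : 1 < K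
  isOpen : IsOpen Ω
  volume_ne_top : volume Ω ≠ ⊤
  shadow_subset : ∀ t, T.shadow t ⊆ cubeDil K (T.kk t) (T.zz t)
  measurable : Measurable q
  one_lt_p : 1 < p
  one_le_L : 1 ≤ L
  p_le : ∀ t, p ≤ m t
  le_Qp : ∀ t, m t ≤ Qp
  bounds : ∀ᵐ x ∂(volume.restrict Ω), p ≤ q x ∧ q x ≤ Qp
  near : ∀ t, ∀ᵐ x ∂(volume.restrict Ω), x ∈ cubeDil K (T.kk t) (T.zz t) →
    m t ≤ q x ∧ cubeVol n (T.kk t) ^ (q x - m t) ≤ L ∧ cubeVol n (T.kk t) ^ (-(q x - m t)) ≤ L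

/-- The average size of `g` below `t`, relative to the size of `Q_t`. -/
def density (g : Eucl n → ℝ) (t : T.ι) : ℝ :=
  (∫⁻ x in T.E t, ENNReal.ofReal |g x|).toReal / cubeVol n (T.kk t)

theorem density_nonneg (g : Eucl n → ℝ) (t : T.ι) : 0 ≤ T.density g t :=
  div_nonneg ENNReal.toReal_nonneg (cubeVol_pos _).le

theorem density_mul_cubeVol (g : Eucl n → ℝ) (t : T.ι) :
    T.density g t * cubeVol n (T.kk t) = (∫⁻ x in T.E t, ENNReal.ofReal |g x|).toReal :=
  div_mul_cancel₀ _ (cubeVol_pos _).ne'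

theorem tsum_volume_P_le (I : Set T.ι) {A : Set (Eucl n)} (hA : ∀ s ∈ I, T.P s ⊆ A) :
    ∑' s, I.indicator (fun s => ENNReal.ofReal (cubeVol n (T.kk s))) s ≤ volume A := by
  have := T.countable
  have hfun : (fun s => ENNReal.ofReal (cubeVol n (T.kk s))) = fun s => volume (T.P s) :=
    funext fun s => (T.volume_P s).symm
  rw [hfun, ← tsum_subtype I fun s => volume (T.P s),
    ← measure_iUnion (f := fun i : I => T.P i)
      (fun i j hij => T.disjoint_P fun h => hij (Subtype.ext h)) fun i => T.measurableSet_P i]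
  exact measure_mono (iUnion_subset fun s => hA s s.2)

theorem tsum_cubeVol_le : ∑' s, ENNReal.ofReal (cubeVol n (T.kk s)) ≤ volume Ω := by
  simpa using T.tsum_volume_P_le univ (A := Ω) fun s _ => T.P_subset s

theorem setLIntegral_E_le (f : Eucl n → ENNReal) (t : T.ι) :
    ∫⁻ x in T.E t, f x ≤ ∑' k, levelSum T.parent T.depth (fun s => ∫⁻ x in T.P s, f x) k t := by
  have := T.countable
  have hE : T.E t = ⋃ k, ⋃ s : treeLevel T.parent T.depth k t, T.P s := by
    ext x
    simp only [E, treeDesc, mem_iUnion, exists_prop, Subtype.exists]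
    exact ⟨fun ⟨s, ⟨k, hk⟩, hx⟩ => ⟨k, s, hk, hx⟩, fun ⟨k, s, hk, hx⟩ => ⟨s, ⟨k, hk⟩, hx⟩⟩
  rw [hE]
  refine (lintegral_iUnion_le _ _).trans (ENNReal.tsum_le_tsum fun k => ?_)
  refine (lintegral_iUnion_le _ _).trans ?_
  rw [levelSum, ← tsum_subtype]

variable {T} {q : Eucl n → ℝ} {K p Qp L : ℝ} {m : T.ι → ℝ}

namespace ControlsExponent

theorem U_subset (h : T.ControlsExponent q K p Qp L m) {k : ℕ} {s t : T.ι}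
    (hs : s ∈ treeLevel T.parent T.depth k t) : T.U s ⊆ cubeDil K (T.kk t) (T.zz t) :=
  (Set.subset_biUnion_of_mem (u := fun s => T.U s) (show s ∈ {s | ∃ m : ℕ, T.parent^[m] s = t}
    from ⟨k, hs.1⟩)).trans (h.shadow_subset t)

theorem U_subset_self (h : T.ControlsExponent q K p Qp L m) (t : T.ι) :
    T.U t ⊆ cubeDil K (T.kk t) (T.zz t) :=
  h.U_subset (k := 0) (by simp [treeLevel_zero])

theorem tsum_levelSum_cubeVol_le (h : T.ControlsExponent q K p Qp L m) (t : T.ι) :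
    ∑' k, levelSum T.parent T.depth (fun s => ENNReal.ofReal (cubeVol n (T.kk s))) k t
      ≤ ENNReal.ofReal (K ^ n) * ENNReal.ofReal (cubeVol n (T.kk t)) := by
  refine (tsum_levelSum_le_tsum_treeDesc _ t).trans ?_
  rw [← volume_cubeDil (by linarith [h.one_lt_K]) (T.kk t) (T.zz t)]
  refine T.tsum_volume_P_le _ fun s hs => ?_
  obtain ⟨k, hk⟩ := mem_iUnion.1 hs
  exact (T.P_subset_U s).trans (h.U_subset hk)

theorem lintegral_abs_le (h : T.ControlsExponent q K p Qp L m) {g : Eucl n → ℝ}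
    (hg : modular Ω q g ≤ 1) :
    ∫⁻ x in Ω, ENNReal.ofReal |g x| ≤ volume Ω + 1 := by
  refine le_trans (lintegral_mono_ae ?_) (lintegral_one_add_le hg)
  filter_upwards [h.bounds] with x hx
  rw [← ENNReal.ofReal_one, ← ENNReal.ofReal_add zero_le_one (by positivity)]
  refine ENNReal.ofReal_le_ofReal ?_
  simpa using rpow_le_one_add_rpow (abs_nonneg (g x)) zero_le_one (by linarith [h.one_lt_p, hx.1])

theorem density_mul_cubeVol_le (h : T.ControlsExponent q K p Qp L m) {g : Eucl n → ℝ}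
    (hg : modular Ω q g ≤ 1) (t : T.ι) :
    T.density g t * cubeVol n (T.kk t) ≤ (volume Ω).toReal + 1 := by
  rw [T.density_mul_cubeVol]
  have h1 : ∫⁻ x in T.E t, ENNReal.ofReal |g x| ≤ volume Ω + 1 :=
    (lintegral_mono_set (T.E_subset t)).trans (h.lintegral_abs_le hg)
  have h2 := ENNReal.toReal_mono (by simp [h.volume_ne_top]) h1
  rwa [ENNReal.toReal_add h.volume_ne_top (by simp), ENNReal.toReal_one] at h2

theorem setLIntegral_P_le (h : T.ControlsExponent q K p Qp L m) (g : Eucl n → ℝ) {k : ℕ}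
    {s t : T.ι} (hs : s ∈ treeLevel T.parent T.depth k t) {y : ℝ} (hy : 0 < y) :
    ∫⁻ x in T.P s, ENNReal.ofReal |g x| ≤ ENNReal.ofReal y * ENNReal.ofReal (cubeVol n (T.kk s))
      + ENNReal.ofReal (y ^ (1 - m t)) *
        ∫⁻ x in T.P s, (1 + ENNReal.ofReal (|g x| ^ q x)) := by
  have hsub : T.P s ⊆ cubeDil K (T.kk t) (T.zz t) := (T.P_subset_U s).trans (h.U_subset hs)
  rw [← T.volume_P, ← setLIntegral_const, ← lintegral_const_mul' _ _ ENNReal.ofReal_ne_top,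
    ← lintegral_add_left measurable_const]
  refine lintegral_mono_ae ?_
  filter_upwards [ae_restrict_of_ae_restrict_of_subset (T.P_subset s) (h.near t),
    ae_restrict_mem (T.measurableSet_P s)] with x hx hxP
  have hm1 : 1 ≤ m t := by linarith [h.one_lt_p, h.p_le t]
  have h1 := le_add_rpow_mul_rpow (abs_nonneg (g x)) hy hm1
  have h2 := rpow_le_one_add_rpow (abs_nonneg (g x)) (by linarith) (hx (hsub hxP)).1
  have hy' : 0 < y ^ (1 - m t) := Real.rpow_pos_of_pos hy _
  rw [← ENNReal.ofReal_one, ← ENNReal.ofReal_add zero_le_one (by positivity),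
    ← ENNReal.ofReal_mul hy'.le, ← ENNReal.ofReal_add hy.le (by positivity)]
  refine ENNReal.ofReal_le_ofReal (h1.trans ?_)
  gcongr

/-- The Hardy inequality for the densities of functions in the unit ball. -/
theorem exists_tsum_density_le (h : T.ControlsExponent q K p Qp L m) :
    ∃ H : ENNReal, H ≠ ⊤ ∧ ∀ g : Eucl n → ℝ, modular Ω q g ≤ 1 →
      ∑' t, ENNReal.ofReal (cubeVol n (T.kk t) * T.density g t ^ m t) ≤ H := by
  have := T.countable
  set A : ℝ := K ^ n with hA
  have hA1 : 1 ≤ A := one_le_pow₀ h.one_lt_K.le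
  refine ⟨ENNReal.ofReal (2 * (4 * A) ^ Qp) *
      ((1 - ENNReal.ofReal ((1 + 1 / (2 * A)) ^ (1 - p)))⁻¹ * (volume Ω + 1)), ?_, ?_⟩
  · refine ENNReal.mul_ne_top ENNReal.ofReal_ne_top (ENNReal.mul_ne_top ?_ ?_)
    · rw [ENNReal.inv_ne_top, ← pos_iff_ne_zero, tsub_pos_iff_lt, ← ENNReal.ofReal_one]
      refine (ENNReal.ofReal_lt_ofReal_iff one_pos).2 ?_
      refine Real.rpow_lt_one_of_one_lt_of_neg ?_ (by linarith [h.one_lt_p])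
      have : 0 < 1 / (2 * A) := by positivity
      linarith
    · simp [h.volume_ne_top]
  · intro g hg
    refine (hardy_tree T.depth_root T.depth_parent (fun t => cubeVol_pos (T.kk t)) hA1
      h.tsum_levelSum_cubeVol_le (fun s => ∫⁻ x in T.P s, ENNReal.ofReal |g x|)
      (fun s => ∫⁻ x in T.P s, (1 + ENNReal.ofReal (|g x| ^ q x))) h.one_lt_p h.p_le h.le_Qp
      (T.density_nonneg g) (fun t k s hs y hy => h.setLIntegral_P_le g hs hy)
      (fun t => ?_)).trans ?_
    · rw [T.density_mul_cubeVol]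
      exact ENNReal.ofReal_toReal_le.trans (T.setLIntegral_E_le _ t)
    · gcongr
      rw [← lintegral_iUnion T.measurableSet_P fun i j hij => T.disjoint_P hij]
      exact (lintegral_mono_set (iUnion_subset T.P_subset)).trans (lintegral_one_add_le hg)

end ControlsExponent

end WhitneyTreeCovering

theorem rpow_le_mul_one_add_rpow {α w D L C m q Qp : ℝ} (hα : 0 ≤ α) (hw : 0 < w) (hD : 1 ≤ D)
    (hL : 1 ≤ L) (hC : 1 ≤ C) (hm : 0 ≤ m) (hmq : m ≤ q) (hqQ : q ≤ Qp) (hαw : α * w ≤ D)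
    (hwL : w ^ (-(q - m)) ≤ L) : (C * α) ^ q ≤ C ^ Qp * (D ^ Qp * L) * (1 + α ^ m) := by
  have hDQ : 1 ≤ D ^ Qp := Real.one_le_rpow hD (by linarith)
  have hαm : 0 ≤ α ^ m := Real.rpow_nonneg hα m
  have hDL : 1 ≤ D ^ Qp * L := one_le_mul_of_one_le_of_one_le hDQ hL
  rw [Real.mul_rpow (by linarith) hα, mul_assoc]
  refine mul_le_mul (Real.rpow_le_rpow_of_exponent_le hC hqQ) ?_ (Real.rpow_nonneg hα q)
    (by positivity)
  rcases le_or_gt α 1 with h | h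
  · have := Real.rpow_le_one hα h (hm.trans hmq)
    nlinarith
  · have h0 : 0 < α := by linarith
    have hle : α ≤ D / w := (le_div_iff₀ hw).2 hαw
    have h1 : α ^ (q - m) ≤ D ^ Qp * L := by
      calc α ^ (q - m) ≤ (D / w) ^ (q - m) := Real.rpow_le_rpow hα hle (by linarith)
        _ = D ^ (q - m) * w ^ (-(q - m)) := by
            rw [Real.div_rpow (by linarith) hw.le, Real.rpow_neg hw.le, div_eq_mul_inv]
        _ ≤ D ^ Qp * L := by
            gcongr
            linarith
    have h2 : α ^ q = α ^ (q - m) * α ^ m := by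
      rw [← Real.rpow_add h0]
      simp
    rw [h2]
    nlinarith

theorem abs_add_sub_rpow_le {a b c q Qp : ℝ} (hq : 0 ≤ q) (hqQ : q ≤ Qp) :
    |a + b - c| ^ q ≤ 3 ^ Qp * (|a| ^ q + |b| ^ q + |c| ^ q) := by
  have hmain : ∀ v : ℝ, 0 ≤ v → |a + b - c| ≤ 3 * v → |a + b - c| ^ q ≤ 3 ^ Qp * v ^ q := by
    intro v hv h
    calc |a + b - c| ^ q ≤ (3 * v) ^ q := Real.rpow_le_rpow (abs_nonneg _) h hq
      _ = 3 ^ q * v ^ q := Real.mul_rpow (by norm_num) hv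
      _ ≤ 3 ^ Qp * v ^ q := by
          gcongr
          norm_num
  have htri : |a + b - c| ≤ |a| + |b| + |c| := (abs_sub _ _).trans (by linarith [abs_add_le a b])
  have ha := Real.rpow_nonneg (abs_nonneg a) q
  have hb := Real.rpow_nonneg (abs_nonneg b) q
  have hc := Real.rpow_nonneg (abs_nonneg c) q
  have h3 : (0 : ℝ) ≤ 3 ^ Qp := by positivity
  rcases le_total |a| |b| with hab | hab <;> rcases le_total |b| |c| with hbc | hbc <;>
    rcases le_total |a| |c| with hac | hac
  all_goals
    first
    | exact (hmain |a| (abs_nonneg a) (by linarith)).trans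
        (mul_le_mul_of_nonneg_left (by linarith) h3)
    | exact (hmain |b| (abs_nonneg b) (by linarith)).trans
        (mul_le_mul_of_nonneg_left (by linarith) h3)
    | exact (hmain |c| (abs_nonneg c) (by linarith)).trans
        (mul_le_mul_of_nonneg_left (by linarith) h3)

namespace WhitneyTreeCovering

variable {n : ℕ} {Ω : Set (Eucl n)} (T : WhitneyTreeCovering n Ω)

theorem measurableSet_U (t : T.ι) : MeasurableSet (T.U t) := (isOpen_cubeU _ _).measurableSet

theorem volume_U (t : T.ι) :
    volume (T.U t) = ENNReal.ofReal ((17 / 16) ^ n * cubeVol n (T.kk t)) := volume_cubeU _ _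

theorem parentBridge_of_ne (g : Eucl n → ℝ) {s : T.ι} (hs : s ≠ T.root) :
    T.parentBridge g s = T.bridge g s := by
  ext x
  simp [parentBridge, hs]

theorem parentBridge_eq_zero (g : Eucl n → ℝ) {s : T.ι} {x : Eucl n} (hx : x ∉ T.U s) :
    T.parentBridge g s x = 0 := by
  rw [parentBridge]
  split_ifs with hs
  · rfl
  · exact T.bridge_eq_zero fun h => hx (T.Bt_sub s hs h).1

theorem measurable_parentBridge (g : Eucl n → ℝ) (s : T.ι) : Measurable (T.parentBridge g s) := by
  by_cases hs : s = T.root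
  · have : T.parentBridge g s = fun _ => 0 := by
      ext x
      simp [parentBridge, hs]
    rw [this]
    exact measurable_const
  · rw [T.parentBridge_of_ne g hs]
    exact measurable_const.indicator (T.Bt_open s).measurableSet

theorem abs_setIntegral_E_le (g : Eucl n → ℝ) (t : T.ι) :
    |∫ x in T.E t, g x| ≤ T.density g t * cubeVol n (T.kk t) := by
  rw [T.density_mul_cubeVol]
  simpa [Real.enorm_eq_ofReal_abs] using
    norm_integral_le_lintegral_norm (μ := volume.restrict (T.E t)) g

theorem abs_parentBridge_le (g : Eucl n → ℝ) (s : T.ι) (x : Eucl n) :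
    |T.parentBridge g s x| ≤ max T.C₂ 1 * T.density g s := by
  have hnn : 0 ≤ max T.C₂ 1 * T.density g s :=
    mul_nonneg (le_max_of_le_right zero_le_one) (T.density_nonneg g s)
  rw [parentBridge]
  split_ifs with hs
  · simpa using hnn
  · by_cases hx : x ∈ T.Bt s
    · have hB := T.volume_Bt_toReal_pos hs
      rw [bridge, Set.indicator_of_mem hx, abs_div, abs_of_pos hB, div_le_iff₀ hB]
      refine (T.abs_setIntegral_E_le g s).trans ?_
      have h1 : cubeVol n (T.kk s) ≤ max T.C₂ 1 * (volume (T.Bt s)).toReal :=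
        (T.cubeVol_le_mul_volume_Bt hs).trans
          (mul_le_mul_of_nonneg_right (le_max_left _ _) hB.le)
      calc T.density g s * cubeVol n (T.kk s)
          ≤ T.density g s * (max T.C₂ 1 * (volume (T.Bt s)).toReal) :=
            mul_le_mul_of_nonneg_left h1 (T.density_nonneg g s)
        _ = _ := by ring
    · simpa [T.bridge_eq_zero hx] using hnn

variable {T} {q : Eucl n → ℝ} {K p Qp L : ℝ} {m : T.ι → ℝ}

namespace ControlsExponent

theorem modular_parentBridge_le (h : T.ControlsExponent q K p Qp L m) {g : Eucl n → ℝ}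
    (hg : modular Ω q g ≤ 1) (s : T.ι) :
    modular Ω q (T.parentBridge g s) ≤
      ENNReal.ofReal (max T.C₂ 1 ^ Qp * (((volume Ω).toReal + 1) ^ Qp * L) * (17 / 16) ^ n) *
        (ENNReal.ofReal (cubeVol n (T.kk s)) +
          ENNReal.ofReal (cubeVol n (T.kk s) * T.density g s ^ m s)) := by
  set B := max T.C₂ 1 ^ Qp * (((volume Ω).toReal + 1) ^ Qp * L) with hB
  have hw := cubeVol_pos (n := n) (T.kk s)
  have hα := T.density_nonneg g s
  have hαm : 0 ≤ T.density g s ^ m s := Real.rpow_nonneg hα _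
  have hC1 : 1 ≤ max T.C₂ 1 := le_max_right _ _
  have hV : 0 ≤ (volume Ω).toReal := ENNReal.toReal_nonneg
  have hL := h.one_le_L
  have hB0 : 0 ≤ B := by positivity
  have hm0 : 1 < m s := h.one_lt_p.trans_le (h.p_le s)
  have hpt : ∀ᵐ x ∂(volume.restrict Ω), ENNReal.ofReal (|T.parentBridge g s x| ^ q x) ≤
      (T.U s).indicator (fun _ => ENNReal.ofReal (B * (1 + T.density g s ^ m s))) x := by
    filter_upwards [h.near s, h.bounds] with x hx hxb
    have hq0 : 0 < q x := by linarith [hxb.1, h.one_lt_p]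
    by_cases hxU : x ∈ T.U s
    · rw [Set.indicator_of_mem hxU]
      obtain ⟨h1, h2, h3⟩ := hx (h.U_subset_self s hxU)
      refine ENNReal.ofReal_le_ofReal ?_
      refine (Real.rpow_le_rpow (abs_nonneg _) (T.abs_parentBridge_le g s x) hq0.le).trans ?_
      exact rpow_le_mul_one_add_rpow hα hw (by linarith) hL hC1 (by linarith) h1 hxb.2
        (h.density_mul_cubeVol_le hg s) h3
    · rw [T.parentBridge_eq_zero g hxU, abs_zero, Real.zero_rpow hq0.ne']
      simp
  calc modular Ω q (T.parentBridge g s)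
      ≤ ∫⁻ x in Ω, (T.U s).indicator
          (fun _ => ENNReal.ofReal (B * (1 + T.density g s ^ m s))) x := lintegral_mono_ae hpt
    _ ≤ ∫⁻ x, (T.U s).indicator
          (fun _ => ENNReal.ofReal (B * (1 + T.density g s ^ m s))) x :=
        setLIntegral_le_lintegral _ _
    _ = ENNReal.ofReal (B * (1 + T.density g s ^ m s)) *
          ENNReal.ofReal ((17 / 16) ^ n * cubeVol n (T.kk s)) := by
        rw [lintegral_indicator_const (T.measurableSet_U s), T.volume_U]
    _ = _ := by
        rw [← ENNReal.ofReal_add hw.le (by positivity), ← ENNReal.ofReal_mul (by positivity),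
          ← ENNReal.ofReal_mul (by positivity)]
        congr 1
        ring

theorem exists_tsum_modular_parentBridge_le (h : T.ControlsExponent q K p Qp L m) :
    ∃ H : ENNReal, H ≠ ⊤ ∧ ∀ g : Eucl n → ℝ, modular Ω q g ≤ 1 →
      ∑' s, modular Ω q (T.parentBridge g s) ≤ H := by
  obtain ⟨H, hH, hHg⟩ := h.exists_tsum_density_le
  refine ⟨ENNReal.ofReal (max T.C₂ 1 ^ Qp * (((volume Ω).toReal + 1) ^ Qp * L) * (17 / 16) ^ n) *
    (volume Ω + H), ENNReal.mul_ne_top ENNReal.ofReal_ne_top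
      (ENNReal.add_ne_top.2 ⟨h.volume_ne_top, hH⟩), fun g hg => ?_⟩
  refine (ENNReal.tsum_le_tsum fun s => h.modular_parentBridge_le hg s).trans ?_
  rw [ENNReal.tsum_mul_left, ENNReal.tsum_add]
  gcongr
  · exact T.tsum_cubeVol_le
  · exact hHg g hg

theorem ofReal_childBridges_rpow_le (g : Eucl n → ℝ) (t : T.ι) {x : Eucl n} (hq : 0 < q x) :
    ENNReal.ofReal (|T.childBridges g t x| ^ q x) ≤
      ∑' c : T.children t, ENNReal.ofReal (|T.parentBridge g c x| ^ q x) := by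
  by_cases hx : ∃ c : T.children t, x ∈ T.Bt c
  · obtain ⟨c, hc⟩ := hx
    rw [T.childBridges_eq g c hc, ← T.parentBridge_of_ne g c.2.1]
    exact ENNReal.le_tsum (f := fun c : T.children t =>
      ENNReal.ofReal (|T.parentBridge g c x| ^ q x)) c
  · push Not at hx
    rw [T.childBridges_eq_zero g hx, abs_zero, Real.zero_rpow hq.ne']
    simp

theorem modular_childBridges_le (h : T.ControlsExponent q K p Qp L m) (g : Eucl n → ℝ)
    (t : T.ι) : modular Ω q (T.childBridges g t) ≤
      ∑' c, (T.children t).indicator (fun c => modular Ω q (T.parentBridge g c)) c := by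
  have := T.countable
  rw [← tsum_subtype]
  simp only [modular]
  rw [← lintegral_tsum fun c => ?_]
  · refine lintegral_mono_ae ?_
    filter_upwards [h.bounds] with x hx
    exact ofReal_childBridges_rpow_le g t (by linarith [hx.1, h.one_lt_p])
  · exact (((T.measurable_parentBridge g c).abs.pow h.measurable).ennreal_ofReal).aemeasurable

theorem tsum_modular_indicator_le (h : T.ControlsExponent q K p Qp L m) {g : Eucl n → ℝ}
    (hgm : Measurable g) : ∑' t, modular Ω q ((T.P t).indicator g) ≤ modular Ω q g := by
  have := T.countable
  simp only [modular]
  rw [← lintegral_tsum fun t => ?_]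
  · refine lintegral_mono_ae ?_
    filter_upwards [h.bounds, T.ae_mem_iUnion_P] with x hx ⟨t₀, ht₀⟩
    have hq : 0 < q x := by linarith [hx.1, h.one_lt_p]
    rw [tsum_eq_single t₀ fun t ht => ?_, Set.indicator_of_mem ht₀]
    rw [Set.indicator_of_notMem fun hxt => Set.disjoint_left.1 (T.disjoint_P ht) hxt ht₀,
      abs_zero, Real.zero_rpow hq.ne', ENNReal.ofReal_zero]
  · exact (((hgm.indicator (T.measurableSet_P t)).abs.pow h.measurable).ennreal_ofReal).aemeasurable

theorem modular_decomp_le (h : T.ControlsExponent q K p Qp L m) {g : Eucl n → ℝ}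
    (hgm : Measurable g) (t : T.ι) :
    modular Ω q (T.decomp g t) ≤ ENNReal.ofReal (3 ^ Qp) *
      (modular Ω q ((T.P t).indicator g) + modular Ω q (T.childBridges g t) +
        modular Ω q (T.parentBridge g t)) := by
  simp only [modular]
  rw [← lintegral_add_left' ?_, ← lintegral_add_right', ← lintegral_const_mul' _ _
    ENNReal.ofReal_ne_top]
  · refine lintegral_mono_ae ?_
    filter_upwards [h.bounds] with x hx
    rw [← ENNReal.ofReal_add (by positivity) (by positivity),
      ← ENNReal.ofReal_add (by positivity) (by positivity), ← ENNReal.ofReal_mul (by positivity)]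
    exact ENNReal.ofReal_le_ofReal
      (abs_add_sub_rpow_le (by linarith [hx.1, h.one_lt_p]) hx.2)
  · exact ((T.measurable_parentBridge g t).abs.pow h.measurable).ennreal_ofReal.aemeasurable
  · exact ((hgm.indicator (T.measurableSet_P t)).abs.pow h.measurable).ennreal_ofReal.aemeasurable

/-- The pieces of a function in the unit ball have uniformly summable modulars. -/
theorem exists_tsum_modular_decomp_le (h : T.ControlsExponent q K p Qp L m) :
    ∃ H : ENNReal, H ≠ ⊤ ∧ ∀ g : Eucl n → ℝ, Measurable g → modular Ω q g ≤ 1 →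
      ∑' t, modular Ω q (T.decomp g t) ≤ H := by
  obtain ⟨H, hH, hHg⟩ := h.exists_tsum_modular_parentBridge_le
  refine ⟨ENNReal.ofReal (3 ^ Qp) * (1 + H + H), ENNReal.mul_ne_top ENNReal.ofReal_ne_top
    (by simp [hH]), fun g hgm hg => ?_⟩
  refine (ENNReal.tsum_le_tsum fun t => h.modular_decomp_le hgm t).trans ?_
  rw [ENNReal.tsum_mul_left, ENNReal.tsum_add, ENNReal.tsum_add]
  gcongr
  · exact (h.tsum_modular_indicator_le hgm).trans hg
  · exact (ENNReal.tsum_le_tsum fun t => h.modular_childBridges_le g t).trans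
      ((tsum_children_le _).trans (hHg g hg))
  · exact hHg g hg

end ControlsExponent

end WhitneyTreeCovering

/-! ### Norm estimates -/

theorem rpow_div_le {w L a m : ℝ} (hw : 0 < w) (hL : 1 ≤ L) (hm : 1 ≤ m) (h : w ^ a ≤ L) :
    w ^ (a / m) ≤ L := by
  rw [div_eq_mul_inv, Real.rpow_mul hw.le]
  calc (w ^ a) ^ m⁻¹ ≤ L ^ m⁻¹ := by gcongr
    _ ≤ L ^ (1 : ℝ) := Real.rpow_le_rpow_of_exponent_le hL (inv_le_one_of_one_le₀ hm)
    _ = L := Real.rpow_one L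

theorem rpow_div_eq_mul {w m q : ℝ} (hw : 0 < w) (hm : 1 ≤ m) :
    (w ^ (1 / m)) ^ q = w * w ^ ((q - m) / m) := by
  have hm0 : m ≠ 0 := by positivity
  have e : 1 / m * q = 1 + (q - m) / m := by
    field_simp
    ring
  rw [← Real.rpow_mul hw.le, e, Real.rpow_add hw, Real.rpow_one]

theorem div_rpow_le_div {v J w L m q : ℝ} (hv : 0 ≤ v) (hw : 0 < w) (hwJ : w ≤ J) (hL : 1 ≤ L)
    (hm : 1 ≤ m) (hmq : m ≤ q) (h : w ^ (-(q - m)) ≤ L) :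
    (v / (L * J ^ (1 / m))) ^ q ≤ v ^ q / J := by
  have hJ : 0 < J := hw.trans_le hwJ
  have hL0 : 0 < L := by linarith
  rw [Real.div_rpow hv (by positivity), Real.mul_rpow hL0.le (by positivity),
    rpow_div_eq_mul hJ hm]
  refine div_le_div_of_nonneg_left (Real.rpow_nonneg hv q) hJ ?_
  have h1 : 1 ≤ L * w ^ ((q - m) / m) := by
    have h2 := rpow_div_le hw hL hm h
    rw [neg_div, Real.rpow_neg hw.le] at h2
    have h3 := Real.rpow_pos_of_pos hw ((q - m) / m)
    exact (inv_le_iff_one_le_mul₀ h3).1 h2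
  have h4 : w ^ ((q - m) / m) ≤ J ^ ((q - m) / m) :=
    Real.rpow_le_rpow hw.le hwJ (div_nonneg (by linarith) (by linarith))
  have h5 : L ≤ L ^ q := by
    simpa using Real.rpow_le_rpow_of_exponent_le hL (hm.trans hmq)
  calc J = 1 * J := (one_mul J).symm
    _ ≤ (L ^ q * J ^ ((q - m) / m)) * J := by
        gcongr
        refine h1.trans ?_
        gcongr
    _ = _ := by ring

theorem div_le_inv_rpow {l w L m q : ℝ} (hl : 0 < l) (hw : 0 < w) (hL : 1 ≤ L) (hm : 1 ≤ m)
    (hmq : m ≤ q) (h : w ^ (q - m) ≤ L) (hr : 1 ≤ w ^ (1 / m) / L / l) :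
    w ^ (1 / m) / L / l / w ≤ (1 / l) ^ q := by
  set r := w ^ (1 / m) / L / l with hrdef
  have hL0 : 0 < L := by linarith
  have hw1 : 0 < w ^ (1 / m) := Real.rpow_pos_of_pos hw _
  have e : 1 / l = r * (L / w ^ (1 / m)) := by
    rw [hrdef]
    field_simp
  have h1 : r ≤ r ^ q := by simpa using Real.rpow_le_rpow_of_exponent_le hr (hm.trans hmq)
  have h5 : L ≤ L ^ q := by simpa using Real.rpow_le_rpow_of_exponent_le hL (hm.trans hmq)
  have h2 := rpow_div_le hw hL hm h
  have h3 := Real.rpow_pos_of_pos hw ((q - m) / m)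
  rw [e, Real.mul_rpow (by linarith) (by positivity), Real.div_rpow hL0.le hw1.le,
    rpow_div_eq_mul hw hm, div_eq_mul_inv]
  refine mul_le_mul h1 ?_ (by positivity) (by positivity)
  rw [le_div_iff₀ (by positivity), inv_mul_cancel_left₀ hw.ne']
  exact h2.trans h5

theorem rpow_le_mul_div {b J w L H m q Qp : ℝ} (hb : 0 ≤ b) (hw : 0 < w) (hwJ : w ≤ J)
    (hJH : J ≤ H) (hH : 1 ≤ H) (hL : 1 ≤ L) (hm : 1 ≤ m) (hmq : m ≤ q) (hqQ : q ≤ Qp)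
    (h : w ^ (-(q - m)) ≤ L) (hbJ : b ≤ L ^ 2 * (J / w) ^ (1 / m)) :
    b ^ q ≤ (L ^ 2) ^ Qp * (H ^ Qp * L) * (J / w) := by
  have hJ : 0 < J := hw.trans_le hwJ
  have hJw : 0 < J / w := by positivity
  have hqm : 0 ≤ (q - m) / m := div_nonneg (by linarith) (by linarith)
  have h1 : (J / w) ^ ((q - m) / m) ≤ H ^ Qp * L := by
    rw [Real.div_rpow hJ.le hw.le, div_eq_mul_inv, ← Real.rpow_neg hw.le, ← neg_div]
    refine mul_le_mul ?_ (rpow_div_le hw hL hm h) (by positivity) (by positivity)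
    refine (Real.rpow_le_rpow hJ.le hJH hqm).trans (Real.rpow_le_rpow_of_exponent_le hH ?_)
    refine (div_le_self (by linarith) hm).trans (by linarith)
  calc b ^ q ≤ (L ^ 2 * (J / w) ^ (1 / m)) ^ q := Real.rpow_le_rpow hb hbJ (by linarith)
    _ = (L ^ 2) ^ q * ((J / w) * (J / w) ^ ((q - m) / m)) := by
        rw [Real.mul_rpow (by positivity) (by positivity), rpow_div_eq_mul hJw hm]
    _ ≤ (L ^ 2) ^ Qp * ((J / w) * (H ^ Qp * L)) := by
        gcongr
        exact one_le_pow₀ hL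
    _ = _ := by ring

section Lux

variable {n : ℕ} {A : Set (Eucl n)} {q f : Eucl n → ℝ}

theorem luxNorm_nonneg : 0 ≤ luxNorm A q f := Real.sInf_nonneg fun _ hl => hl.1.le

theorem luxNorm_le {l : ℝ} (hl : 0 < l)
    (h : ∫⁻ x in A, ENNReal.ofReal ((|f x| / l) ^ q x) ≤ 1) : luxNorm A q f ≤ l :=
  csInf_le ⟨0, fun _ hl => hl.1.le⟩ ⟨hl, h⟩

open scoped Pointwise in
theorem luxNorm_div {l : ℝ} (hl : 0 < l) :
    luxNorm A q (fun x => f x / l) = luxNorm A q f / l := by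
  have key : {r : ℝ | 0 < r ∧ ∫⁻ x in A, ENNReal.ofReal ((|f x / l| / r) ^ q x) ≤ 1} =
      l⁻¹ • {r : ℝ | 0 < r ∧ ∫⁻ x in A, ENNReal.ofReal ((|f x| / r) ^ q x) ≤ 1} := by
    ext r
    rw [Set.mem_inv_smul_set_iff₀ hl.ne']
    simp only [mem_ofPred_eq, smul_eq_mul, abs_div, abs_of_pos hl, div_div,
      mul_pos_iff_of_pos_left hl]
  rw [luxNorm, key, Real.sInf_smul_of_nonneg (by positivity), smul_eq_mul, luxNorm]
  field_simp

end Lux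

namespace WhitneyTreeCovering

variable {n : ℕ} {Ω : Set (Eucl n)} {T : WhitneyTreeCovering n Ω}
  {q : Eucl n → ℝ} {K p Qp L : ℝ} {m : T.ι → ℝ}

/-- The normalized norm of the piece `f` supported in `U_t`. -/
def normRatio (T : WhitneyTreeCovering n Ω) (q f : Eucl n → ℝ) (t : T.ι) : ℝ :=
  luxNorm Ω q ((T.U t).indicator f) / luxNorm Ω q (charFun (T.U t))

theorem normRatio_nonneg (f : Eucl n → ℝ) (t : T.ι) : 0 ≤ T.normRatio q f t :=
  div_nonneg luxNorm_nonneg luxNorm_nonneg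

theorem normRatio_div (f : Eucl n → ℝ) (t : T.ι) {l : ℝ} (hl : 0 < l) :
    T.normRatio q (fun x => f x / l) t = T.normRatio q f t / l := by
  have : (T.U t).indicator (fun x => f x / l) = fun x => (T.U t).indicator f x / l := by
    ext x
    by_cases hx : x ∈ T.U t <;> simp [hx]
  rw [normRatio, normRatio, this, luxNorm_div hl]
  ring

namespace ControlsExponent

theorem one_lt_m (h : T.ControlsExponent q K p Qp L m) (t : T.ι) : 1 < m t :=
  h.one_lt_p.trans_le (h.p_le t)

theorem luxNorm_indicator_le (h : T.ControlsExponent q K p Qp L m) (t : T.ι) {f : Eucl n → ℝ}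
    {J : ℝ} (hJ : cubeVol n (T.kk t) ≤ J) (hf : modular Ω q f ≤ ENNReal.ofReal J) :
    luxNorm Ω q ((T.U t).indicator f) ≤ L * J ^ (1 / m t) := by
  have hw := cubeVol_pos (n := n) (T.kk t)
  have hJ0 : 0 < J := hw.trans_le hJ
  have hL0 : 0 < L := by linarith [h.one_le_L]
  refine luxNorm_le (by positivity) ?_
  calc ∫⁻ x in Ω, ENNReal.ofReal ((|(T.U t).indicator f x| / (L * J ^ (1 / m t))) ^ q x)
      ≤ ∫⁻ x in Ω, ENNReal.ofReal (|f x| ^ q x) * (ENNReal.ofReal J)⁻¹ := by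
        refine lintegral_mono_ae ?_
        filter_upwards [h.bounds, h.near t] with x hxb hx
        have hq : 0 < q x := by linarith [hxb.1, h.one_lt_p]
        by_cases hxU : x ∈ T.U t
        · obtain ⟨h1, h2, h3⟩ := hx (h.U_subset_self t hxU)
          rw [Set.indicator_of_mem hxU, ← div_eq_mul_inv, ← ENNReal.ofReal_div_of_pos hJ0]
          exact ENNReal.ofReal_le_ofReal (div_rpow_le_div (abs_nonneg _) hw hJ h.one_le_L
            (h.one_lt_m t).le h1 h3)
        · rw [Set.indicator_of_notMem hxU, abs_zero, zero_div, Real.zero_rpow hq.ne']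
          simp
    _ = modular Ω q f * (ENNReal.ofReal J)⁻¹ :=
        lintegral_mul_const' _ _ (by simp [hJ0])
    _ ≤ ENNReal.ofReal J * (ENNReal.ofReal J)⁻¹ := by gcongr
    _ ≤ 1 := ENNReal.mul_inv_le_one _

theorem le_luxNorm_charFun (h : T.ControlsExponent q K p Qp L m) (t : T.ι) :
    cubeVol n (T.kk t) ^ (1 / m t) / L ≤ luxNorm Ω q (charFun (T.U t)) := by
  have hw := cubeVol_pos (n := n) (T.kk t)
  refine le_csInf ⟨(volume Ω).toReal + 1, ?_⟩ ?_
  · have hV : 0 ≤ (volume Ω).toReal := ENNReal.toReal_nonneg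
    refine ⟨by positivity, ?_⟩
    calc ∫⁻ x in Ω, ENNReal.ofReal ((|charFun (T.U t) x| / ((volume Ω).toReal + 1)) ^ q x)
        ≤ ∫⁻ x in Ω, ENNReal.ofReal (1 / ((volume Ω).toReal + 1)) := by
          refine lintegral_mono_ae ?_
          filter_upwards [h.bounds] with x hx
          refine ENNReal.ofReal_le_ofReal ?_
          have hc : |charFun (T.U t) x| ≤ 1 := by
            by_cases hxU : x ∈ T.U t <;> simp [_root_.charFun, hxU]
          have h1 : 1 / ((volume Ω).toReal + 1) ≤ 1 := by
            rw [div_le_one (by positivity)]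
            linarith
          calc (|charFun (T.U t) x| / ((volume Ω).toReal + 1)) ^ q x
              ≤ (1 / ((volume Ω).toReal + 1)) ^ q x := by
                refine Real.rpow_le_rpow (by positivity) (by gcongr) ?_
                linarith [hx.1, h.one_lt_p]
            _ ≤ (1 / ((volume Ω).toReal + 1)) ^ (1 : ℝ) :=
                Real.rpow_le_rpow_of_exponent_ge (by positivity) h1
                  (by linarith [hx.1, h.one_lt_p])
            _ = _ := Real.rpow_one _
      _ = ENNReal.ofReal (1 / ((volume Ω).toReal + 1)) * ENNReal.ofReal (volume Ω).toReal := by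
          rw [setLIntegral_const, ENNReal.ofReal_toReal h.volume_ne_top]
      _ ≤ 1 := by
          rw [← ENNReal.ofReal_mul (by positivity), ← ENNReal.ofReal_one]
          refine ENNReal.ofReal_le_ofReal ?_
          rw [div_mul_eq_mul_div, div_le_one (by positivity)]
          linarith
  · rintro l ⟨hl, hlI⟩
    by_contra! hlt
    set r := cubeVol n (T.kk t) ^ (1 / m t) / L / l with hr
    have hr1 : 1 < r := (one_lt_div hl).2 hlt
    have hge : ENNReal.ofReal r ≤
        ∫⁻ x in Ω, ENNReal.ofReal ((|charFun (T.U t) x| / l) ^ q x) := by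
      calc ENNReal.ofReal r
          = ∫⁻ x in T.P t, ENNReal.ofReal (r / cubeVol n (T.kk t)) := by
            rw [setLIntegral_const, T.volume_P, ← ENNReal.ofReal_mul (by positivity),
              div_mul_cancel₀ _ hw.ne']
        _ ≤ ∫⁻ x in T.P t, ENNReal.ofReal ((|charFun (T.U t) x| / l) ^ q x) := by
            refine lintegral_mono_ae ?_
            filter_upwards [ae_restrict_of_ae_restrict_of_subset (T.P_subset t) (h.near t),
              ae_restrict_mem (T.measurableSet_P t)] with x hx hxP
            have hxU := T.P_subset_U t hxP
            obtain ⟨h1, h2, h3⟩ := hx (h.U_subset_self t hxU)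
            rw [_root_.charFun, Set.indicator_of_mem hxU, abs_one]
            exact ENNReal.ofReal_le_ofReal
              (div_le_inv_rpow hl hw h.one_le_L (h.one_lt_m t).le h1 h2 hr1.le)
        _ ≤ _ := lintegral_mono_set (T.P_subset t)
    have := hge.trans hlI
    rw [ENNReal.ofReal_le_one] at this
    linarith

theorem normRatio_le (h : T.ControlsExponent q K p Qp L m) (t : T.ι) {f : Eucl n → ℝ}
    {J : ℝ} (hJ : cubeVol n (T.kk t) ≤ J) (hf : modular Ω q f ≤ ENNReal.ofReal J) :
    T.normRatio q f t ≤ L ^ 2 * (J / cubeVol n (T.kk t)) ^ (1 / m t) := by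
  have hw := cubeVol_pos (n := n) (T.kk t)
  have hL0 : 0 < L := by linarith [h.one_le_L]
  have hJ0 : 0 < J := hw.trans_le hJ
  have hw1 : 0 < cubeVol n (T.kk t) ^ (1 / m t) := Real.rpow_pos_of_pos hw _
  calc T.normRatio q f t
      ≤ L * J ^ (1 / m t) / (cubeVol n (T.kk t) ^ (1 / m t) / L) :=
        div_le_div₀ (by positivity) (h.luxNorm_indicator_le t hJ hf) (by positivity)
          (h.le_luxNorm_charFun t)
    _ = _ := by
        rw [Real.div_rpow hJ0.le hw.le]
        field_simp

theorem ae_normRatio_rpow_le (h : T.ControlsExponent q K p Qp L m) (t : T.ι) {f : Eucl n → ℝ}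
    {J H : ℝ} (hJ : cubeVol n (T.kk t) ≤ J) (hf : modular Ω q f ≤ ENNReal.ofReal J)
    (hJH : J ≤ H) (hH : 1 ≤ H) : ∀ᵐ x ∂(volume.restrict Ω), x ∈ T.U t →
      T.normRatio q f t ^ q x ≤
        (L ^ 2) ^ Qp * (H ^ Qp * L) * (J / cubeVol n (T.kk t)) := by
  filter_upwards [h.bounds, h.near t] with x hxb hx hxU
  obtain ⟨h1, h2, h3⟩ := hx (h.U_subset_self t hxU)
  exact rpow_le_mul_div (normRatio_nonneg f t) (cubeVol_pos _) hJ hJH hH h.one_le_L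
    (h.one_lt_m t).le h1 hxb.2 h3 (h.normRatio_le t hJ hf)

end ControlsExponent

end WhitneyTreeCovering

namespace WhitneyTreeCovering

variable {n : ℕ} {Ω : Set (Eucl n)}

/-- Almost every point of `Ω` lies in a nonempty finite family of at most `C₁` cubes `U_t`. -/
theorem ae_exists_finset_mem_U (T : WhitneyTreeCovering n Ω) (hΩ : MeasurableSet Ω) :
    ∀ᵐ x ∂(volume.restrict Ω), ∃ S : Finset T.ι, S.Nonempty ∧ (S.card : ℝ) ≤ T.C₁ ∧
      ∀ t, x ∈ T.U t ↔ t ∈ S := by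
  filter_upwards [ae_restrict_of_ae T.cover, ae_restrict_mem hΩ] with x hx hxΩ
  have h1 : 1 ≤ ∑' t, (T.U t).indicator (fun _ => (1:ℝ)) x := hx.1 hxΩ
  have h2 : ∑' t, (T.U t).indicator (fun _ => (1:ℝ)) x ≤ T.C₁ * Ω.indicator (fun _ => (1:ℝ)) x :=
    hx.2
  rw [Set.indicator_of_mem hxΩ, mul_one] at h2
  have hsum : Summable fun t => (T.U t).indicator (fun _ => (1:ℝ)) x := by
    by_contra hns
    rw [tsum_eq_zero_of_not_summable hns] at h1
    linarith
  have hfin : {t | x ∈ T.U t}.Finite := by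
    have hev := hsum.tendsto_cofinite_zero.eventually (gt_mem_nhds one_pos)
    rw [Filter.eventually_cofinite] at hev
    refine hev.subset fun t ht => ?_
    have hxt : x ∈ T.U t := ht
    simp [hxt]
  have hmem : ∀ t, x ∈ T.U t ↔ t ∈ hfin.toFinset := fun t => by simp
  have hcard : ∑' t, (T.U t).indicator (fun _ => (1:ℝ)) x =
      hfin.toFinset.card := by
    rw [tsum_eq_sum (s := hfin.toFinset) fun t ht =>
      Set.indicator_of_notMem (fun hxt => ht ((hmem t).1 hxt)) _]
    rw [Finset.sum_congr rfl fun t ht => Set.indicator_of_mem ((hmem t).2 ht) _]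
    simp
  refine ⟨hfin.toFinset, ?_, hcard ▸ h2, hmem⟩
  rw [hcard] at h1
  rw [← Finset.card_pos]
  exact_mod_cast (zero_lt_one.trans_le h1)

variable {T : WhitneyTreeCovering n Ω} {q : Eucl n → ℝ} {K p Qp L : ℝ} {m : T.ι → ℝ}

/-- A finite-overlap sum is dominated by its largest term. -/
theorem exists_tsum_indicator_le {b : T.ι → ℝ} (hb : ∀ t, 0 ≤ b t) {x : Eucl n} {S : Finset T.ι}
    (hS : S.Nonempty) (hcard : (S.card : ℝ) ≤ T.C₁) (hmem : ∀ t, x ∈ T.U t ↔ t ∈ S) :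
    ∃ t, x ∈ T.U t ∧ 0 ≤ ∑' t, (T.U t).indicator (fun _ => b t) x ∧
      ∑' t, (T.U t).indicator (fun _ => b t) x ≤ T.C₁ * b t := by
  obtain ⟨t, htS, ht⟩ := S.exists_max_image b hS
  refine ⟨t, (hmem t).2 htS, tsum_nonneg fun s => Set.indicator_nonneg (fun _ _ => hb s) _, ?_⟩
  rw [tsum_eq_sum (s := S) fun s hs => Set.indicator_of_notMem (fun hxt => hs ((hmem s).1 hxt)) _,
    Finset.sum_congr rfl fun s hs => Set.indicator_of_mem ((hmem s).2 hs) _]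
  calc ∑ s ∈ S, b s ≤ S.card • b t := Finset.sum_le_card_nsmul S b _ ht
    _ = S.card * b t := nsmul_eq_mul _ _
    _ ≤ T.C₁ * b t := mul_le_mul_of_nonneg_right hcard (hb t)

namespace ControlsExponent

theorem luxNorm_tsum_le (h : T.ControlsExponent q K p Qp L m) {b J : T.ι → ℝ} {B H : ℝ}
    (hb : ∀ t, 0 ≤ b t) (hJ : ∀ t, 0 ≤ J t) (hB : 0 ≤ B) (hH : 0 ≤ H)
    (hbJ : ∀ t, ∀ᵐ x ∂(volume.restrict Ω), x ∈ T.U t →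
      b t ^ q x ≤ B * (J t / cubeVol n (T.kk t)))
    (hJH : ∑' t, ENNReal.ofReal (J t) ≤ ENNReal.ofReal H) :
    luxNorm Ω q (fun x => ∑' t, (T.U t).indicator (fun _ => b t) x) ≤
      T.C₁ * (1 + B * (17 / 16) ^ n * H) := by
  have := T.countable
  have hC₁ := T.one_le_C₁
  set R : ℝ := 1 + B * (17 / 16) ^ n * H with hR
  have hR1 : 1 ≤ R := by
    have : 0 ≤ B * (17 / 16) ^ n * H := by positivity
    linarith
  refine luxNorm_le (by positivity) ?_
  calc ∫⁻ x in Ω, ENNReal.ofReal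
        ((|∑' t, (T.U t).indicator (fun _ => b t) x| / (T.C₁ * R)) ^ q x)
      ≤ ∫⁻ x in Ω, ∑' t, (T.U t).indicator
          (fun _ => ENNReal.ofReal (R⁻¹ * (B * (J t / cubeVol n (T.kk t))))) x := by
        refine lintegral_mono_ae ?_
        filter_upwards [T.ae_exists_finset_mem_U h.isOpen.measurableSet, h.bounds,
          ae_all_iff.2 hbJ] with x ⟨S, hS, hcard, hmem⟩ hxb hx
        obtain ⟨t, hxt, h0, hle⟩ := exists_tsum_indicator_le hb hS hcard hmem
        have hq : 1 ≤ q x := by linarith [hxb.1, h.one_lt_p]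
        refine le_trans ?_ (ENNReal.le_tsum t)
        rw [Set.indicator_of_mem hxt, abs_of_nonneg h0]
        refine ENNReal.ofReal_le_ofReal ?_
        calc ((∑' t, (T.U t).indicator (fun _ => b t) x) / (T.C₁ * R)) ^ q x
            ≤ (R⁻¹ * b t) ^ q x := by
              refine Real.rpow_le_rpow (by positivity) ?_ (by linarith)
              rw [div_le_iff₀ (by positivity)]
              refine hle.trans (le_of_eq ?_)
              field_simp
          _ = R⁻¹ ^ q x * b t ^ q x := Real.mul_rpow (by positivity) (hb t)
          _ ≤ R⁻¹ * (B * (J t / cubeVol n (T.kk t))) := by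
              refine mul_le_mul ?_ (hx t hxt) (Real.rpow_nonneg (hb t) _) (by positivity)
              simpa using Real.rpow_le_rpow_of_exponent_ge (by positivity)
                (inv_le_one_of_one_le₀ hR1) hq
    _ = ∑' t, ∫⁻ x in Ω, (T.U t).indicator
          (fun _ => ENNReal.ofReal (R⁻¹ * (B * (J t / cubeVol n (T.kk t))))) x :=
        lintegral_tsum fun t => (measurable_const.indicator (T.measurableSet_U t)).aemeasurable
    _ ≤ ∑' t, ENNReal.ofReal (R⁻¹ * (B * (17 / 16) ^ n)) * ENNReal.ofReal (J t) := by
        refine ENNReal.tsum_le_tsum fun t => (setLIntegral_le_lintegral _ _).trans (le_of_eq ?_)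
        have hw := cubeVol_pos (n := n) (T.kk t)
        have hJt := hJ t
        rw [lintegral_indicator_const (T.measurableSet_U t), T.volume_U,
          ← ENNReal.ofReal_mul (by positivity), ← ENNReal.ofReal_mul (by positivity)]
        congr 1
        field_simp
    _ ≤ ENNReal.ofReal (R⁻¹ * (B * (17 / 16) ^ n)) * ENNReal.ofReal H := by
        rw [ENNReal.tsum_mul_left]
        gcongr
    _ ≤ 1 := by
        rw [← ENNReal.ofReal_mul (by positivity), ← ENNReal.ofReal_one]
        refine ENNReal.ofReal_le_ofReal ?_
        rw [mul_assoc, inv_mul_le_iff₀ (by positivity), mul_one]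
        linarith

/-- The norm bound for the decomposition of functions in the unit ball. -/
theorem exists_luxNorm_le_of_modular_le_one (h : T.ControlsExponent q K p Qp L m) :
    ∃ C : ℝ, ∀ g : Eucl n → ℝ, Measurable g → modular Ω q g ≤ 1 →
      luxNorm Ω q (fun x => ∑' t, (T.U t).indicator
        (fun _ => T.normRatio q (T.decomp g t) t) x) ≤ C := by
  obtain ⟨H, hH, hHg⟩ := h.exists_tsum_modular_decomp_le
  set H' : ℝ := H.toReal + (volume Ω).toReal with hH'
  have hH'0 : 0 ≤ H' := by positivity
  have hL := h.one_le_L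
  refine ⟨T.C₁ * (1 + (L ^ 2) ^ Qp * ((H' + 1) ^ Qp * L) * (17 / 16) ^ n * H'),
    fun g hgm hg => ?_⟩
  have hJtop : ∀ t, modular Ω q (T.decomp g t) ≠ ⊤ := fun t =>
    ((ENNReal.le_tsum t).trans (hHg g hgm hg)).trans_lt hH.lt_top |>.ne
  set J : T.ι → ℝ := fun t => (modular Ω q (T.decomp g t)).toReal + cubeVol n (T.kk t) with hJdef
  have hJeq : ∀ t, ENNReal.ofReal (J t) =
      modular Ω q (T.decomp g t) + ENNReal.ofReal (cubeVol n (T.kk t)) := fun t => by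
    rw [hJdef, ENNReal.ofReal_add ENNReal.toReal_nonneg (cubeVol_pos _).le,
      ENNReal.ofReal_toReal (hJtop t)]
  have hJw : ∀ t, cubeVol n (T.kk t) ≤ J t := fun t =>
    le_add_of_nonneg_left ENNReal.toReal_nonneg
  have hJ0 : ∀ t, 0 ≤ J t := fun t => (cubeVol_pos _).le.trans (hJw t)
  have hsum : ∑' t, ENNReal.ofReal (J t) ≤ ENNReal.ofReal H' := by
    rw [hH', ENNReal.ofReal_add ENNReal.toReal_nonneg ENNReal.toReal_nonneg,
      ENNReal.ofReal_toReal hH, ENNReal.ofReal_toReal h.volume_ne_top]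
    simp_rw [hJeq]
    rw [ENNReal.tsum_add]
    exact add_le_add (hHg g hgm hg) T.tsum_cubeVol_le
  have hJH : ∀ t, J t ≤ H' + 1 := fun t => by
    have := (ENNReal.le_tsum t).trans hsum
    rw [ENNReal.ofReal_le_ofReal_iff hH'0] at this
    linarith
  refine h.luxNorm_tsum_le (fun t => normRatio_nonneg _ t) hJ0 (by positivity) hH'0
    (fun t => h.ae_normRatio_rpow_le t (hJw t) ?_ (hJH t) (by linarith)) hsum
  rw [hJeq]
  exact le_self_add

/-- The norm bound for the decomposition. -/
theorem exists_luxNorm_le (h : T.ControlsExponent q K p Qp L m) :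
    ∃ C : ℝ, ∀ g : Eucl n → ℝ, Measurable g → MemVarLp Ω q g →
      luxNorm Ω q (fun x => ∑' t, (T.U t).indicator
        (fun _ => T.normRatio q (T.decomp g t) t) x) ≤ C * luxNorm Ω q g := by
  obtain ⟨C, hC⟩ := h.exists_luxNorm_le_of_modular_le_one
  refine ⟨max C 1, fun g hgm hg => ?_⟩
  have hC0 : 0 < max C 1 := lt_max_of_lt_right one_pos
  rw [← div_le_iff₀' hC0]
  refine le_csInf hg ?_
  rintro l ⟨hl, hlI⟩
  have hmod : modular Ω q (fun x => g x / l) ≤ 1 := by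
    simpa only [modular, abs_div, abs_of_pos hl] using hlI
  have hdec : ∀ t, T.normRatio q (T.decomp (fun x => g x / l) t) t =
      T.normRatio q (T.decomp g t) t / l := fun t => by
    rw [← normRatio_div _ t hl]
    congr 1
    exact funext fun x => T.decomp_div g l t x
  have hF : (fun x => ∑' t, (T.U t).indicator
      (fun _ => T.normRatio q (T.decomp (fun x => g x / l) t) t) x) =
      fun x => (∑' t, (T.U t).indicator (fun _ => T.normRatio q (T.decomp g t) t) x) / l := by
    ext x
    rw [← tsum_div_const]
    refine tsum_congr fun t => ?_
    by_cases hx : x ∈ T.U t <;> simp [hx, hdec]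
  have key := (hC _ (hgm.div_const l) hmod).trans (le_max_left C 1)
  rw [hF, luxNorm_div hl, div_le_iff₀ hl] at key
  rwa [div_le_iff₀' hC0]

end ControlsExponent

end WhitneyTreeCovering

/-- Theorem 5.4, decomposition of mean-zero functions on John domains. -/
theorem decomposition_john
    (n : ℕ) (K : ℝ) (hK : 1 < K) :
    ∃ τK : ℝ, 1 ≤ τK ∧
      ∀ (Ω : Set (Eucl n)), IsOpen Ω → IsConnected Ω → Bornology.IsBounded Ω →
      ∀ lam : ℝ, 1 < lam → JohnDomain Ω lam →
      ∀ T : WhitneyTreeCovering n Ω,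
        (∀ t : T.ι, T.shadow t ⊆ cubeDil K (T.kk t) (T.zz t)) →
        ∀ q : Eucl n → ℝ, Measurable q → (∀ x ∈ Ω, 1 ≤ q x) →
          (∃ M : ℝ, ∀ᵐ x ∂(volume.restrict Ω), q x ≤ M) →
          1 < essInfOn q Ω →
          (∃ C₀ : ℝ, 0 < C₀ ∧ BoundaryLH Ω q τK C₀) →
          ∃ C : ℝ, ∀ g : Eucl n → ℝ, Measurable g → MemVarLp Ω q g →
            IntegrableOn g Ω volume → (∫ x in Ω, g x) = 0 →
            ∃ gt : T.ι → Eucl n → ℝ,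
              (∀ t, IntegrableOn (gt t) Ω volume) ∧
              (∀ᵐ x ∂(volume.restrict Ω), g x = ∑' t : T.ι, gt t x) ∧
              (∀ t, Function.support (gt t) ⊆ T.U t) ∧
              (∀ t, (∫ x in T.U t, gt t x) = 0) ∧
              luxNorm Ω q (fun x => ∑' t : T.ι,
                  Set.indicator (T.U t)
                    (fun _ => luxNorm Ω q (Set.indicator (T.U t) (gt t))
                      / luxNorm Ω q (charFun (T.U t))) x)
                ≤ C * luxNorm Ω q g := by
  refine ⟨K * (n + 1), one_le_mul_of_one_le_of_one_le hK.le (by simp), ?_⟩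
  rintro Ω hΩo - hΩb - - - T hT q hqm hq1 ⟨M, hM⟩ hp ⟨C₀, hC₀, hLH⟩
  have hvol : volume Ω ≠ ⊤ := hΩb.measure_lt_top.ne
  have hbdd : IsBoundedUnder (· ≥ ·) (ae (volume.restrict Ω)) q :=
    isBoundedUnder_of_eventually_ge (a := 1)
      ((ae_restrict_mem hΩo.measurableSet).mono fun x hx => hq1 x hx)
  have hq : ∀ᵐ x ∂(volume.restrict Ω),
      essInfOn q Ω ≤ q x ∧ q x ≤ max (essInfOn q Ω) M := by
    filter_upwards [ae_essInf_le (hf := hbdd), hM] with x hx hxM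
    exact ⟨hx, le_max_of_le_right hxM⟩
  obtain ⟨L, hL, m, hm⟩ := exists_local_exponent hK hvol T (zero_lt_one.trans hp)
    (le_max_left _ M) hq hC₀ hLH
  have hctrl : T.ControlsExponent q K (essInfOn q Ω) (max (essInfOn q Ω) M) L m :=
    ⟨hK, hΩo, hvol, hT, hqm, hp, hL, fun t => (hm t).1, fun t => (hm t).2.1, hq,
      fun t => (hm t).2.2⟩
  obtain ⟨C, hC⟩ := hctrl.exists_luxNorm_le
  exact ⟨C, fun g hgm hg hgi hg0 => ⟨T.decomp g, fun t => (T.integrable_decomp hgi t).integrableOn,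
    T.ae_eq_tsum_decomp g, T.support_decomp_subset g, T.integral_decomp hgi hg0, hC g hgm hg⟩⟩
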